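/- Let m, n ≥ 1 and for 1 ≤ i ≤ m+n-1 set β_i = m/i if i ≤ m and β_i = n/(m+n-i) if i > m. Let g_t = diag(e^{nt},…,e^{nt}, e^{-mt},…,e^{-mt}) ∈ SL(m+n, ℝ). Then there exists c > 0 depending only on m, n such that for every t ≥ 1 and every nonzero decomposable v ∈ ⋀^i ℝ^{m+n}, ∫_{SO(m+n)} ‖g_t k v‖^{-β_i} dk ≤ c · t · e^{-mnt} · ‖v‖^{-β_i}, where dk is the Haar probability measure on SO(m+n). -/

import Mathlib

open MeasureTheory

instance matrixMeasurableSpace (d : ℕ) : MeasurableSpace (Matrix (Fin d) (Fin d) ℝ) :=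
  (inferInstance : MeasurableSpace (Fin d → Fin d → ℝ))

/-- The norm of the wedge product `x₁ ∧ ⋯ ∧ x_i` in `⋀^i ℝ^d`, via the Gram determinant. -/
noncomputable def wedgeNorm {d i : ℕ} (x : Fin i → (Fin d → ℝ)) : ℝ :=
  Real.sqrt (Matrix.det (Matrix.of fun a b : Fin i => ∑ j, x a j * x b j))

/-- `g_t = diag(e^{nt},…,e^{nt},e^{-mt},…,e^{-mt})` with `m` copies of `e^{nt}` and `n`
copies of `e^{-mt}`. -/
noncomputable def gt (m n : ℕ) (t : ℝ) : Matrix (Fin (m + n)) (Fin (m + n)) ℝ :=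
  Matrix.diagonal fun j => if (j : ℕ) < m then Real.exp (n * t) else Real.exp (-(m * t))

/-- The exponents `β_i = m/i` for `i ≤ m`, `β_i = n/(m+n-i)` for `i > m`. -/
noncomputable def betaExp (m n i : ℕ) : ℝ :=
  if i ≤ m then (m : ℝ) / i else (n : ℝ) / ((m : ℝ) + n - i)

section Gram

open scoped Matrix

lemma wedgeNorm_nonneg {d i : ℕ} (x : Fin i → Fin d → ℝ) : 0 ≤ wedgeNorm x :=
  Real.sqrt_nonneg _

lemma wedgeNorm_eq {d i : ℕ} (x : Fin i → Fin d → ℝ) :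
    wedgeNorm x = √(Matrix.of x * (Matrix.of x)ᵀ).det := rfl

lemma gram_posSemidef {d i : ℕ} (x : Fin i → Fin d → ℝ) :
    (Matrix.of x * (Matrix.of x)ᵀ).PosSemidef := by
  simpa using Matrix.posSemidef_self_mul_conjTranspose (Matrix.of x)

lemma of_mulVec {d i : ℕ} (A : Matrix (Fin d) (Fin d) ℝ) (x : Fin i → Fin d → ℝ) :
    Matrix.of (fun a => A.mulVec (x a)) = Matrix.of x * Aᵀ := by
  ext a b
  simp [Matrix.mul_apply, Matrix.mulVec, dotProduct, mul_comm]

lemma wedgeNorm_mulVec_eq {d i : ℕ} (A : Matrix (Fin d) (Fin d) ℝ) (x : Fin i → Fin d → ℝ) :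
    wedgeNorm (fun a => A.mulVec (x a))
      = √(Matrix.of x * (Aᵀ * A) * (Matrix.of x)ᵀ).det := by
  rw [wedgeNorm_eq, of_mulVec, Matrix.transpose_mul, Matrix.transpose_transpose]
  simp only [Matrix.mul_assoc]

lemma wedgeNorm_mulVec_orthogonal {d i : ℕ} {A : Matrix (Fin d) (Fin d) ℝ}
    (hA : A ∈ Matrix.orthogonalGroup (Fin d) ℝ) (x : Fin i → Fin d → ℝ) :
    wedgeNorm (fun a => A.mulVec (x a)) = wedgeNorm x := by
  rw [wedgeNorm_mulVec_eq, (Matrix.mem_orthogonalGroup_iff' (Fin d) ℝ).1 hA, Matrix.mul_one,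
    wedgeNorm_eq]

/-- A change of spanning vectors multiplies the norm by the determinant. -/
lemma wedgeNorm_linearComb {d i : ℕ} (R : Matrix (Fin i) (Fin i) ℝ) (x : Fin i → Fin d → ℝ) :
    wedgeNorm (fun a => ∑ b, R a b • x b) = |R.det| * wedgeNorm x := by
  have h : Matrix.of (fun a => ∑ b, R a b • x b) = R * Matrix.of x := by
    ext a j
    simp [Matrix.mul_apply]
  have h2 : R * Matrix.of x * (R * Matrix.of x)ᵀ = R * (Matrix.of x * (Matrix.of x)ᵀ) * Rᵀ := by
    rw [Matrix.transpose_mul]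
    simp only [Matrix.mul_assoc]
  rw [wedgeNorm_eq, wedgeNorm_eq, h, h2, Matrix.det_mul, Matrix.det_mul, Matrix.det_transpose,
    mul_right_comm, Real.sqrt_mul (mul_self_nonneg _), Real.sqrt_mul_self_eq_abs]

lemma wedgeNorm_smul {d i : ℕ} (r : ℝ) (hr : 0 ≤ r) (x : Fin i → Fin d → ℝ) :
    wedgeNorm (fun a j => r * x a j) = r ^ i * wedgeNorm x := by
  have := wedgeNorm_linearComb (r • (1 : Matrix (Fin i) (Fin i) ℝ)) x
  rw [Matrix.det_smul, Matrix.det_one, mul_one, Fintype.card_fin, abs_of_nonneg (pow_nonneg hr i)]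
    at this
  rw [← this]
  congr 1
  ext a j
  simp [Matrix.one_apply, ite_apply]

/-- Adjoining a vector multiplies the norm by at least any of its coordinates orthogonal to the
previous vectors. -/
lemma abs_mul_wedgeNorm_le_wedgeNorm_cons {d p : ℕ} (y : Fin p → Fin d → ℝ) (x u : Fin d → ℝ)
    (hu : u ⬝ᵥ u = 1) (huy : ∀ a, u ⬝ᵥ y a = 0) :
    |u ⬝ᵥ x| * wedgeNorm y ≤ wedgeNorm (Fin.cons x y : Fin (p + 1) → Fin d → ℝ) := by
  set z : Fin d → ℝ := x - (u ⬝ᵥ x) • u with hz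
  set M : Matrix (Fin (p + 1)) (Fin (p + 1)) ℝ :=
    Matrix.of (Fin.cons x y : Fin (p + 1) → Fin d → ℝ) *
      (Matrix.of (Fin.cons x y : Fin (p + 1) → Fin d → ℝ))ᵀ with hM
  set N : Matrix (Fin (p + 1)) (Fin (p + 1)) ℝ :=
    Matrix.of (Fin.cons z y : Fin (p + 1) → Fin d → ℝ) *
      (Matrix.of (Fin.cons z y : Fin (p + 1) → Fin d → ℝ))ᵀ with hN
  have entry : ∀ (w : Fin d → ℝ) (a b : Fin (p + 1)),
      (Matrix.of (Fin.cons w y : Fin (p + 1) → Fin d → ℝ) *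
        (Matrix.of (Fin.cons w y : Fin (p + 1) → Fin d → ℝ))ᵀ) a b
        = (Fin.cons w y : Fin (p + 1) → Fin d → ℝ) a ⬝ᵥ
          (Fin.cons w y : Fin (p + 1) → Fin d → ℝ) b := fun w a b => rfl
  have hyu : ∀ a, y a ⬝ᵥ u = 0 := fun a => by rw [dotProduct_comm]; exact huy a
  have hzy : ∀ a, z ⬝ᵥ y a = x ⬝ᵥ y a := fun a => by
    simp [hz, sub_dotProduct, huy]
  have hyz : ∀ a, y a ⬝ᵥ z = y a ⬝ᵥ x := fun a => by
    simp [hz, dotProduct_sub, hyu]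
  have hzz : z ⬝ᵥ z = x ⬝ᵥ x - (u ⬝ᵥ x) ^ 2 := by
    simp only [hz, sub_dotProduct, dotProduct_sub, smul_dotProduct, dotProduct_smul, hu,
      dotProduct_comm x u, smul_eq_mul]
    ring
  have hdet : M.det = N.det + (u ⬝ᵥ x) ^ 2 * (Matrix.of y * (Matrix.of y)ᵀ).det := by
    have hsub : ∀ j : Fin (p + 1), M.submatrix Fin.succ j.succAbove
        = N.submatrix Fin.succ j.succAbove := by
      intro j
      ext a b
      simp only [Matrix.submatrix_apply, hM, hN, entry, Fin.cons_succ]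
      refine Fin.cases ?_ (fun c => ?_) (j.succAbove b)
      · simp [hyz]
      · simp
    have h0 : M.submatrix Fin.succ (Fin.succAbove 0) = Matrix.of y * (Matrix.of y)ᵀ := by
      ext a b
      simp only [Matrix.submatrix_apply, hM, entry, Fin.cons_succ, Fin.zero_succAbove]
      rfl
    rw [Matrix.det_succ_row_zero M, Matrix.det_succ_row_zero N, Fin.sum_univ_succ,
      Fin.sum_univ_succ]
    simp only [← hsub]
    rw [h0]
    have hs : ∀ j : Fin p, M 0 j.succ = N 0 j.succ := fun j => by
      simp [hM, hN, entry, hzy]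
    have h00 : M 0 0 = N 0 0 + (u ⬝ᵥ x) ^ 2 := by
      simp [hM, hN, entry, hzz]
    simp only [hs, h00]
    simp
    ring
  have hNn : 0 ≤ N.det := (gram_posSemidef _).det_nonneg
  rw [wedgeNorm_eq, wedgeNorm_eq, ← Real.sqrt_sq_eq_abs, ← Real.sqrt_mul (sq_nonneg _)]
  apply Real.sqrt_le_sqrt
  change _ ≤ M.det
  linarith

lemma det_le_det_add_vecMulVec {i : ℕ} {A : Matrix (Fin i) (Fin i) ℝ} (hA : A.PosSemidef)
    (u : Fin i → ℝ) : A.det ≤ (A + Matrix.vecMulVec u u).det := by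
  have hB : (Matrix.vecMulVec u u).PosSemidef := by
    simpa using Matrix.posSemidef_vecMulVec_self_star u
  by_cases h : A.det = 0
  · rw [h]
    exact (hA.add hB).det_nonneg
  · have hinv := (hA.inv).dotProduct_mulVec_nonneg u
    rw [Matrix.vecMulVec_eq Unit, Matrix.det_add_replicateCol_mul_replicateRow
      (isUnit_iff_ne_zero.2 h)]
    have hx : (Matrix.replicateRow Unit u * A⁻¹ * Matrix.replicateCol Unit u) default default
        = u ⬝ᵥ (A⁻¹ *ᵥ u) := by
      rw [Matrix.mul_assoc]
      simp [Matrix.mul_apply, dotProduct, Matrix.mulVec]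
    rw [Matrix.det_unique (1 + _), Matrix.add_apply, hx, Matrix.one_apply_eq]
    have : 0 ≤ A.det := hA.det_nonneg
    simp only [star_trivial] at hinv
    nlinarith [mul_nonneg this hinv]

lemma wedgeNorm_mono_diagonal {d i : ℕ} (x : Fin i → Fin d → ℝ) (f g : Fin d → ℝ)
    (hfg : ∀ j, (f j) ^ 2 ≤ (g j) ^ 2) :
    wedgeNorm (fun a j => f j * x a j) ≤ wedgeNorm (fun a j => g j * x a j) := by
  rw [wedgeNorm_eq, wedgeNorm_eq]
  apply Real.sqrt_le_sqrt
  set A := Matrix.of (fun a j => f j * x a j) * (Matrix.of (fun a j => f j * x a j))ᵀ with hA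
  set u : Fin d → Fin i → ℝ := fun j a => √((g j) ^ 2 - (f j) ^ 2) * x a j with hu
  have hB : Matrix.of (fun a j => g j * x a j) * (Matrix.of (fun a j => g j * x a j))ᵀ
      = A + ∑ j, Matrix.vecMulVec (u j) (u j) := by
    ext a b
    rw [Matrix.add_apply, Matrix.sum_apply]
    simp only [hA, Matrix.mul_apply, Matrix.of_apply, Matrix.transpose_apply,
      Matrix.vecMulVec_apply, hu]
    rw [← Finset.sum_add_distrib]
    refine Finset.sum_congr rfl fun j _ => ?_
    have := Real.mul_self_sqrt (sub_nonneg.2 (hfg j))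
    linear_combination (- x a j * x b j) * this
  rw [hB]
  have key : ∀ s : Finset (Fin d), (A + ∑ j ∈ s, Matrix.vecMulVec (u j) (u j)).PosSemidef ∧
      A.det ≤ (A + ∑ j ∈ s, Matrix.vecMulVec (u j) (u j)).det := by
    intro s
    induction s using Finset.induction_on with
    | empty => simpa using gram_posSemidef _
    | insert j s hj ih =>
      rw [Finset.sum_insert hj, add_comm (Matrix.vecMulVec _ _), ← add_assoc]
      refine ⟨ih.1.add ?_, ih.2.trans (det_le_det_add_vecMulVec ih.1 _)⟩
      simpa using Matrix.posSemidef_vecMulVec_self_star (u j)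
  exact (key _).2

/-- Orthogonal triangularisation: the rows of `U` from index `b` on are orthogonal to `X a` for
`a < b`. -/
lemma exists_orthogonal_triangular {d : ℕ} (X : Fin d → Fin d → ℝ) :
    ∃ U ∈ Matrix.orthogonalGroup (Fin d) ℝ, ∀ a b, a < b → U b ⬝ᵥ X a = 0 := by
  let f : Fin d → EuclideanSpace ℝ (Fin d) := fun a => WithLp.toLp 2 (X a)
  let b := InnerProductSpace.gramSchmidtOrthonormalBasis (𝕜 := ℝ) (by simp) f
  refine ⟨Matrix.of fun i j => b i j, ?_, ?_⟩
  · rw [Matrix.mem_orthogonalGroup_iff]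
    ext i j
    have h := orthonormal_iff_ite.1 b.orthonormal i j
    rw [Matrix.one_apply, ← h]
    simp [Matrix.mul_apply, PiLp.inner_apply, mul_comm]
  · intro i j hij
    have h := InnerProductSpace.gramSchmidtOrthonormalBasis_inv_triangular (𝕜 := ℝ)
      (by simp) f hij
    simpa [PiLp.inner_apply, dotProduct, mul_comm, b, f] using h

lemma exists_specialOrthogonal_triangular {d : ℕ} (X : Fin d → Fin d → ℝ) :
    ∃ U ∈ Matrix.specialOrthogonalGroup (Fin d) ℝ, ∀ a b, a < b → U b ⬝ᵥ X a = 0 := by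
  obtain ⟨U, hU, h⟩ := exists_orthogonal_triangular X
  rcases Nat.eq_zero_or_pos d with rfl | hd
  · exact ⟨U, Matrix.mem_specialOrthogonalGroup_iff.2 ⟨hU, by simp⟩, h⟩
  have hdet : U.det * U.det = 1 := by
    have := congrArg Matrix.det ((Matrix.mem_orthogonalGroup_iff (Fin d) ℝ).1 hU)
    simpa [Matrix.det_mul, Matrix.star_eq_conjTranspose] using this
  set s : Fin d → ℝ := Function.update 1 ⟨0, hd⟩ U.det with hs
  have hss : ∀ a, s a * s a = 1 := by
    intro a
    by_cases ha : a = ⟨0, hd⟩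
    · subst ha; simpa [hs] using hdet
    · simp [hs, ha]
  have hD : Matrix.diagonal s ∈ Matrix.orthogonalGroup (Fin d) ℝ := by
    rw [Matrix.mem_orthogonalGroup_iff]
    simp [hss]
  refine ⟨Matrix.diagonal s * U, Matrix.mem_specialOrthogonalGroup_iff.2
    ⟨mul_mem hD hU, ?_⟩, ?_⟩
  · rw [Matrix.det_mul, Matrix.det_diagonal]
    have : ∏ a, s a = U.det := by
      rw [hs, Finset.prod_update_of_mem (Finset.mem_univ _)]
      simp
    rw [this, hdet]
  · intro a b hab
    have : (Matrix.diagonal s * U) b = s b • U b := by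
      ext j; simp [Matrix.diagonal_mul]
    rw [this, smul_dotProduct, h a b hab, smul_zero]

end Gram

section HaarInvariance

open scoped ENNReal

variable {G : Type*} [Group G] [MeasurableSpace G] [MeasurableMul₂ G] [MeasurableInv G]
  {μ : Measure G} [IsProbabilityMeasure μ]

lemma lintegral_inv_of_map_mul_left (hμ : ∀ k₀ : G, μ.map (fun k => k₀ * k) = μ)
    {f : G → ℝ≥0∞} (hf : Measurable f) : ∫⁻ k, f k⁻¹ ∂μ = ∫⁻ k, f k ∂μ := by
  have left : ∀ (g : G → ℝ≥0∞), Measurable g → ∀ k₀, ∫⁻ k, g (k₀ * k) ∂μ = ∫⁻ k, g k ∂μ := by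
    intro g hg k₀
    conv_rhs => rw [← hμ k₀]
    rw [lintegral_map hg (measurable_const_mul k₀)]
  have h1 : ∫⁻ x, ∫⁻ y, f (x⁻¹ * y) ∂μ ∂μ = ∫⁻ k, f k ∂μ := by
    simp only [left f hf, lintegral_const, measure_univ, mul_one]
  have h2 : ∫⁻ y, ∫⁻ x, f (x⁻¹ * y) ∂μ ∂μ = ∫⁻ k, f k⁻¹ ∂μ := by
    have : ∀ y, ∫⁻ x, f (x⁻¹ * y) ∂μ = ∫⁻ k, f k⁻¹ ∂μ := by
      intro y
      rw [← left (fun k => f k⁻¹) (hf.comp measurable_inv) y⁻¹]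
      simp
    simp only [this, lintegral_const, measure_univ, mul_one]
  rw [← h1, ← h2]
  refine (lintegral_lintegral_swap ?_).symm
  exact (hf.comp ((measurable_fst.inv).mul measurable_snd)).aemeasurable

lemma lintegral_mul_right_of_map_mul_left (hμ : ∀ k₀ : G, μ.map (fun k => k₀ * k) = μ)
    {f : G → ℝ≥0∞} (hf : Measurable f) (k₀ : G) : ∫⁻ k, f (k * k₀) ∂μ = ∫⁻ k, f k ∂μ := by
  have h := lintegral_inv_of_map_mul_left hμ (hf.comp (measurable_mul_const k₀))
  simp only [Function.comp_apply] at h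
  rw [← lintegral_inv_of_map_mul_left hμ hf, ← h]
  have h2 := lintegral_map (μ := μ) (hf.comp measurable_inv) (measurable_const_mul k₀⁻¹)
  rw [hμ k₀⁻¹] at h2
  simpa using h2.symm

end HaarInvariance

section Measurability

open scoped Matrix

lemma measurable_specialOrthogonal_entry {d : ℕ} (a b : Fin d) :
    Measurable fun k : Matrix.specialOrthogonalGroup (Fin d) ℝ =>
      (k : Matrix (Fin d) (Fin d) ℝ) a b := by
  have h : Measurable fun M : Matrix (Fin d) (Fin d) ℝ => M a b :=
    (measurable_pi_apply b).comp (measurable_pi_apply (X := fun _ : Fin d => Fin d → ℝ) a)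
  exact h.comp measurable_subtype_coe

lemma measurable_to_specialOrthogonal {α : Type*} [MeasurableSpace α] {d : ℕ}
    {f : α → Matrix.specialOrthogonalGroup (Fin d) ℝ}
    (hf : ∀ a b, Measurable fun x => (f x : Matrix (Fin d) (Fin d) ℝ) a b) : Measurable f := by
  have h : Measurable fun x => (f x : Matrix (Fin d) (Fin d) ℝ) :=
    measurable_pi_iff.2 fun a => measurable_pi_iff.2 fun b => hf a b
  exact h.subtype_mk

instance measurableMul₂_specialOrthogonal (d : ℕ) :
    MeasurableMul₂ (Matrix.specialOrthogonalGroup (Fin d) ℝ) where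
  measurable_mul := by
    refine measurable_to_specialOrthogonal fun a b => ?_
    simp only [Submonoid.coe_mul, Matrix.mul_apply]
    exact Finset.measurable_sum _ fun j _ =>
      ((measurable_specialOrthogonal_entry a j).comp measurable_fst).mul
        ((measurable_specialOrthogonal_entry j b).comp measurable_snd)

lemma coe_specialOrthogonal_inv {d : ℕ} (k : Matrix.specialOrthogonalGroup (Fin d) ℝ) :
    ((k⁻¹ : Matrix.specialOrthogonalGroup (Fin d) ℝ) : Matrix (Fin d) (Fin d) ℝ)
      = (k : Matrix (Fin d) (Fin d) ℝ)ᵀ := by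
  ext a b
  rfl

instance measurableInv_specialOrthogonal (d : ℕ) :
    MeasurableInv (Matrix.specialOrthogonalGroup (Fin d) ℝ) where
  measurable_inv := by
    refine measurable_to_specialOrthogonal fun a b => ?_
    simp only [coe_specialOrthogonal_inv, Matrix.transpose_apply]
    exact measurable_specialOrthogonal_entry b a

lemma continuous_wedgeNorm {d i : ℕ} : Continuous (wedgeNorm : (Fin i → Fin d → ℝ) → ℝ) := by
  refine Real.continuous_sqrt.comp (Continuous.matrix_det ?_)
  refine continuous_matrix fun a b => ?_
  simp only [Matrix.of_apply]
  fun_prop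

lemma measurable_wedgeNorm {d i : ℕ} : Measurable (wedgeNorm : (Fin i → Fin d → ℝ) → ℝ) :=
  continuous_wedgeNorm.measurable

lemma measurePreserving_orthogonal_mulVec {d : ℕ} {A : Matrix (Fin d) (Fin d) ℝ}
    (hA : A ∈ Matrix.orthogonalGroup (Fin d) ℝ) :
    MeasurePreserving (fun x : Fin d → ℝ => A.mulVec x) volume volume := by
  have hdet : A.det * A.det = 1 := by
    have := congrArg Matrix.det ((Matrix.mem_orthogonalGroup_iff (Fin d) ℝ).1 hA)
    simpa [Matrix.det_mul, Matrix.star_eq_conjTranspose] using this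
  have h0 : A.det ≠ 0 := fun h => by simp [h] at hdet
  have habs : |A.det| = 1 := by
    rcases mul_self_eq_one_iff.1 hdet with h | h <;> simp [h]
  refine ⟨(Continuous.matrix_mulVec continuous_const continuous_id).measurable, ?_⟩
  have := Real.map_matrix_volume_pi_eq_smul_volume_pi h0
  rw [abs_inv, habs, inv_one, ENNReal.ofReal_one, one_smul] at this
  exact this

end Measurability

section Layers

open scoped ENNReal

variable {α : Type*} [MeasurableSpace α] {ρ : Measure α} {N : α → ℝ} {R C q β : ℝ}

lemma ENNReal.rpow_neg_le_rpow_neg {a b : ℝ≥0∞} {β : ℝ} (hβ : 0 ≤ β) (hab : a ≤ b) :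
    b ^ (-β) ≤ a ^ (-β) := by
  rw [ENNReal.rpow_neg, ENNReal.rpow_neg]
  exact ENNReal.inv_le_inv.2 (ENNReal.rpow_le_rpow hab hβ)

lemma exists_exp_layer {y : ℝ} (hR : 0 < R) (hy : 0 < y) (hyR : y ≤ R) :
    ∃ l : ℕ, R * Real.exp (-((l : ℝ) + 1)) < y ∧ y ≤ R * Real.exp (-(l : ℝ)) := by
  have hlog : 0 ≤ Real.log (R / y) := Real.log_nonneg ((one_le_div hy).2 hyR)
  have hexp : y = R * Real.exp (-Real.log (R / y)) := by
    rw [Real.exp_neg, Real.exp_log (div_pos hR hy)]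
    field_simp
  refine ⟨⌊Real.log (R / y)⌋₊, ?_, ?_⟩
  · conv_rhs => rw [hexp]
    gcongr
    exact Nat.lt_floor_add_one _
  · conv_lhs => rw [hexp]
    gcongr
    exact Nat.floor_le hlog

lemma lintegral_layer_le (hR : 0 < R) (hN : Measurable N)
    (hρ : ∀ s, 0 < s → ρ {x | N x ≤ s} ≤ ENNReal.ofReal (C * s ^ q)) (l : ℕ) :
    ∫⁻ x, ENNReal.ofReal (R * Real.exp (-((l : ℝ) + 1))) ^ (-β) *
        {x | N x ≤ R * Real.exp (-(l : ℝ))}.indicator 1 x ∂ρ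
      ≤ ENNReal.ofReal (C * R ^ (q - β) * Real.exp β * Real.exp (-(q - β)) ^ l) := by
  have hms : MeasurableSet {x | N x ≤ R * Real.exp (-(l : ℝ))} :=
      measurableSet_le hN measurable_const
  rw [lintegral_const_mul _ (measurable_one.indicator hms), lintegral_indicator_one hms]
  refine (mul_le_mul_right (hρ _ (by positivity)) _).trans ?_
  rw [ENNReal.ofReal_rpow_of_pos (by positivity), ← ENNReal.ofReal_mul (by positivity)]
  apply le_of_eq
  congr 1
  rw [Real.mul_rpow hR.le (Real.exp_pos _).le, Real.mul_rpow hR.le (Real.exp_pos _).le,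
    ← Real.exp_mul, ← Real.exp_mul, ← Real.exp_nat_mul, sub_eq_add_neg q β, Real.rpow_add hR]
  have : Real.exp (-((l : ℝ) + 1) * -β) * Real.exp (-(l : ℝ) * q)
      = Real.exp β * Real.exp (l * -(q + -β)) := by
    rw [← Real.exp_add, ← Real.exp_add]
    congr 1
    ring
  linear_combination (R ^ (-β) * R ^ q * C) * this

/-- If `N` takes small values `≤ s` with measure `O(s ^ q)`, then `N ^ (-β)` is integrable for
`β < q`. -/
lemma lintegral_rpow_neg_le_tsum (hR : 0 < R) (hβ : 0 ≤ β) (hN : Measurable N)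
    (hN0 : ∀ x, 0 ≤ N x) (hNR : ∀ᵐ x ∂ρ, N x ≤ R)
    (hρ : ∀ s, 0 < s → ρ {x | N x ≤ s} ≤ ENNReal.ofReal (C * s ^ q)) :
    ∫⁻ x, ENNReal.ofReal (N x) ^ (-β) ∂ρ
      ≤ ∑' l : ℕ, ENNReal.ofReal (C * R ^ (q - β) * Real.exp β * Real.exp (-(q - β)) ^ l) := by
  calc ∫⁻ x, ENNReal.ofReal (N x) ^ (-β) ∂ρ
      ≤ ∫⁻ x, ∑' l : ℕ, ENNReal.ofReal (R * Real.exp (-((l : ℝ) + 1))) ^ (-β) *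
        {x | N x ≤ R * Real.exp (-(l : ℝ))}.indicator 1 x ∂ρ := by
        refine lintegral_mono_ae ?_
        filter_upwards [hNR] with x hx
        rcases (hN0 x).eq_or_lt with h0 | hpos
        · have hle : ∀ l : ℕ, ENNReal.ofReal R ^ (-β) ≤
              ENNReal.ofReal (R * Real.exp (-((l : ℝ) + 1))) ^ (-β) *
              {x | N x ≤ R * Real.exp (-(l : ℝ))}.indicator 1 x := by
            intro l
            have hmem : x ∈ {x | N x ≤ R * Real.exp (-(l : ℝ))} := by
              simp only [Set.mem_ofPred_eq, ← h0]; positivity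
            rw [Set.indicator_of_mem hmem, Pi.one_apply, mul_one]
            refine ENNReal.rpow_neg_le_rpow_neg hβ (ENNReal.ofReal_le_ofReal ?_)
            exact mul_le_of_le_one_right hR.le
              (Real.exp_le_one_iff.2 (neg_nonpos.2 (by positivity)))
          refine le_top.trans (Eq.le ?_)
          symm
          rw [eq_top_iff, ← ENNReal.tsum_const_eq_top_of_ne_zero (α := ℕ)
            (c := ENNReal.ofReal R ^ (-β))]
          · exact ENNReal.tsum_le_tsum hle
          · rw [ENNReal.ofReal_rpow_of_pos hR]
            simpa using Real.rpow_pos_of_pos hR _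
        · obtain ⟨l, h1, h2⟩ := exists_exp_layer hR hpos hx
          refine le_trans ?_ (ENNReal.le_tsum l)
          rw [Set.indicator_of_mem (by exact h2), Pi.one_apply, mul_one]
          exact ENNReal.rpow_neg_le_rpow_neg hβ (ENNReal.ofReal_le_ofReal h1.le)
    _ = ∑' l : ℕ, ∫⁻ x, ENNReal.ofReal (R * Real.exp (-((l : ℝ) + 1))) ^ (-β) *
        {x | N x ≤ R * Real.exp (-(l : ℝ))}.indicator 1 x ∂ρ :=
        lintegral_tsum fun l => ((measurable_one.indicator
          (measurableSet_le hN measurable_const)).const_mul _).aemeasurable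
    _ ≤ _ := ENNReal.tsum_le_tsum fun l => lintegral_layer_le hR hN hρ l

lemma tsum_layer_ne_top (hβq : β < q) :
    ∑' l : ℕ, ENNReal.ofReal (C * R ^ (q - β) * Real.exp β * Real.exp (-(q - β)) ^ l) ≠ ∞ := by
  refine Summable.tsum_ofReal_ne_top ?_
  exact (summable_geometric_of_lt_one (Real.exp_pos _).le
    (Real.exp_lt_one_iff.2 (by linarith))).mul_left _

/-- Truncating `N` at height `R * exp (-(L + 1))` costs only a factor `L + 1` in the critical
case `β = q`. -/
lemma lintegral_max_rpow_neg_le (hR : 0 < R) (hβ : 0 ≤ β) (hβq : β ≤ q) (hN : Measurable N)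
    (hNR : ∀ᵐ x ∂ρ, N x ≤ R) (hC : 0 ≤ C)
    (hρ : ∀ s, 0 < s → ρ {x | N x ≤ s} ≤ ENNReal.ofReal (C * s ^ q)) (L : ℕ) :
    ∫⁻ x, ENNReal.ofReal (max (N x) (R * Real.exp (-((L : ℝ) + 1)))) ^ (-β) ∂ρ
      ≤ ((L + 1 : ℕ) : ℝ≥0∞) * ENNReal.ofReal (C * R ^ (q - β) * Real.exp β) := by
  calc ∫⁻ x, ENNReal.ofReal (max (N x) (R * Real.exp (-((L : ℝ) + 1)))) ^ (-β) ∂ρ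
      ≤ ∫⁻ x, ∑ l ∈ Finset.range (L + 1),
        ENNReal.ofReal (R * Real.exp (-((l : ℝ) + 1))) ^ (-β) *
        {x | N x ≤ R * Real.exp (-(l : ℝ))}.indicator 1 x ∂ρ := by
        refine lintegral_mono_ae ?_
        filter_upwards [hNR] with x hx
        obtain ⟨l, hl, h1, h2⟩ : ∃ l ∈ Finset.range (L + 1),
            R * Real.exp (-((l : ℝ) + 1)) ≤ max (N x) (R * Real.exp (-((L : ℝ) + 1))) ∧
            N x ≤ R * Real.exp (-(l : ℝ)) := by
          rcases le_or_gt (N x) (R * Real.exp (-((L : ℝ) + 1))) with h | h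
          · refine ⟨L, by simp, le_max_right _ _, h.trans ?_⟩
            gcongr
            linarith
          · obtain ⟨l, h1, h2⟩ := exists_exp_layer hR (lt_trans (by positivity) h) hx
            refine ⟨l, ?_, h1.le.trans (le_max_left _ _), h2⟩
            have := lt_of_mul_lt_mul_left (h.trans_le h2) hR.le
            rw [Real.exp_lt_exp] at this
            rw [Finset.mem_range]
            have : (l : ℝ) < (L + 1 : ℕ) := by push_cast; linarith
            exact_mod_cast this
        refine le_trans ?_ (Finset.single_le_sum (fun _ _ => zero_le) hl)
        rw [Set.indicator_of_mem (by exact h2), Pi.one_apply, mul_one]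
        exact ENNReal.rpow_neg_le_rpow_neg hβ (ENNReal.ofReal_le_ofReal h1)
    _ = ∑ l ∈ Finset.range (L + 1),
        ∫⁻ x, ENNReal.ofReal (R * Real.exp (-((l : ℝ) + 1))) ^ (-β) *
        {x | N x ≤ R * Real.exp (-(l : ℝ))}.indicator 1 x ∂ρ :=
        lintegral_finsetSum _ fun l _ => (measurable_one.indicator
          (measurableSet_le hN measurable_const)).const_mul _
    _ ≤ ∑ l ∈ Finset.range (L + 1), ENNReal.ofReal (C * R ^ (q - β) * Real.exp β) := by
        refine Finset.sum_le_sum fun l _ => (lintegral_layer_le hR hN hρ l).trans ?_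
        refine ENNReal.ofReal_le_ofReal (mul_le_of_le_one_right (by positivity) ?_)
        exact pow_le_one₀ (Real.exp_pos _).le (Real.exp_le_one_iff.2 (by linarith))
    _ = _ := by simp

end Layers

section Transverse

open scoped ENNReal Matrix

/-- The projection of `ℝ^d` onto the coordinates in `S`. -/
def coordProj {d : ℕ} (S : Finset (Fin d)) (x : Fin d → ℝ) : Fin d → ℝ :=
  fun j => if j ∈ S then x j else 0

/-- Lebesgue measure on the Euclidean ball of radius `2` in `ℝ^d`. -/
noncomputable def ballMeasure (d : ℕ) : Measure (Fin d → ℝ) :=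
  volume.restrict {x | x ⬝ᵥ x ≤ 4}

lemma continuous_coordProj {d : ℕ} (S : Finset (Fin d)) : Continuous (coordProj S) := by
  refine continuous_pi fun j => ?_
  unfold coordProj
  split_ifs
  · exact continuous_apply j
  · exact continuous_const

lemma measurableSet_dotProduct_le (d : ℕ) (r : ℝ) : MeasurableSet {x : Fin d → ℝ | x ⬝ᵥ x ≤ r} :=
  measurableSet_le (Continuous.measurable (by unfold dotProduct; fun_prop)) measurable_const

lemma abs_apply_le_two {d : ℕ} {x : Fin d → ℝ} (hx : x ⬝ᵥ x ≤ 4) (j : Fin d) : |x j| ≤ 2 := by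
  have h : x j * x j ≤ x ⬝ᵥ x :=
    Finset.single_le_sum (f := fun j => x j * x j) (fun j _ => mul_self_nonneg _)
      (Finset.mem_univ j)
  refine abs_le_of_sq_le_sq (by nlinarith) (by norm_num)

lemma mulVec_dotProduct_self {d : ℕ} {U : Matrix (Fin d) (Fin d) ℝ}
    (hU : U ∈ Matrix.orthogonalGroup (Fin d) ℝ) (x y : Fin d → ℝ) :
    U *ᵥ x ⬝ᵥ U *ᵥ y = x ⬝ᵥ y := by
  have h : Uᵀ * U = 1 := (Matrix.mem_orthogonalGroup_iff' (Fin d) ℝ).1 hU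
  rw [Matrix.dotProduct_mulVec, Matrix.vecMul_mulVec, h, Matrix.vecMul_one]

instance isFiniteMeasure_ballMeasure (d : ℕ) : IsFiniteMeasure (ballMeasure d) := by
  refine ⟨?_⟩
  rw [ballMeasure, Measure.restrict_apply_univ]
  refine (measure_mono (t := Set.Icc (fun _ : Fin d => (-2 : ℝ)) (fun _ => 2)) ?_).trans_lt ?_
  · intro x hx
    exact ⟨fun j => (abs_le.1 (abs_apply_le_two hx j)).1,
      fun j => (abs_le.1 (abs_apply_le_two hx j)).2⟩
  · rw [Real.volume_Icc_pi]
    exact ENNReal.prod_lt_top fun _ _ => ENNReal.ofReal_lt_top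

/-- The distance (in a sup norm) from the `S`-projection of `x` to the span of the `S`-projections
of `p < #S` vectors controls the growth of the wedge norm, and takes small values `≤ s` with
measure `O(s ^ (#S - p))`. -/
lemma exists_transverse_norm {d p : ℕ} (S : Finset (Fin d)) (hp : p < S.card)
    (y : Fin p → Fin d → ℝ) :
    ∃ N : (Fin d → ℝ) → ℝ, Measurable N ∧ (∀ x, 0 ≤ N x) ∧ (∀ᵐ x ∂ballMeasure d, N x ≤ 2) ∧
      (∀ s, 0 < s → ballMeasure d {x | N x ≤ s}
        ≤ ENNReal.ofReal (4 ^ d * s ^ ((S.card : ℝ) - p))) ∧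
      ∀ x, N x * wedgeNorm (fun a => coordProj S (y a)) ≤
        wedgeNorm (fun a => coordProj S ((Fin.cons x y : Fin (p + 1) → Fin d → ℝ) a)) := by
  classical
  have hSd : S.card ≤ d := by simpa using S.card_le_univ
  have hcompl : Sᶜ.card = d - S.card := by rw [Finset.card_compl, Fintype.card_fin]
  set b₀ : ℕ := p + (d - S.card) with hb₀
  let e := Sᶜ.equivFin
  let X : Fin d → Fin d → ℝ := fun a =>
    if h : (a : ℕ) < p then coordProj S (y ⟨a, h⟩)
    else if h' : (a : ℕ) - p < Sᶜ.card then Pi.single (e.symm ⟨a - p, h'⟩ : Fin d) 1 else 0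
  obtain ⟨U, hU, hUX⟩ := exists_orthogonal_triangular X
  have hUy : ∀ b : Fin d, b₀ ≤ b → ∀ a, U b ⬝ᵥ coordProj S (y a) = 0 := by
    intro b hb a
    have ha := a.2
    have h := hUX ⟨a, by omega⟩ b (Fin.lt_def.2 (by simp; omega))
    simpa [X] using h
  have hUS : ∀ b : Fin d, b₀ ≤ b → ∀ j ∉ S, U b j = 0 := by
    intro b hb j hj
    set c := e ⟨j, Finset.mem_compl.2 hj⟩ with hc
    have hc2 := c.2
    have hb2 := b.2
    have h := hUX ⟨p + c, by omega⟩ b (Fin.lt_def.2 (by simp; omega))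
    have hX : X ⟨p + c, by omega⟩ = Pi.single j 1 := by
      have h1 : ¬ (p + (c : ℕ) < p) := by omega
      have h2 : p + (c : ℕ) - p < Sᶜ.card := by omega
      have h3 : (⟨p + (c : ℕ) - p, h2⟩ : Fin Sᶜ.card) = c := Fin.ext (by simp)
      simp only [X, h1, h2, dif_pos, dif_neg, not_false_eq_true, h3]
      simp [hc]
    rw [hX] at h
    simpa using h
  have hUP : ∀ b : Fin d, b₀ ≤ b → ∀ x, U b ⬝ᵥ coordProj S x = U b ⬝ᵥ x := by
    intro b hb x
    refine Finset.sum_congr rfl fun j _ => ?_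
    by_cases hj : j ∈ S
    · simp [coordProj, hj]
    · simp [hUS b hb j hj]
  have hUU : ∀ b, U b ⬝ᵥ U b = 1 := by
    intro b
    have h := congrFun (congrFun ((Matrix.mem_orthogonalGroup_iff (Fin d) ℝ).1 hU) b) b
    simpa [Matrix.mul_apply, dotProduct] using h
  let T := {b : Fin d // b₀ ≤ b}
  have hNle : ∀ (x : Fin d → ℝ) (s : ℝ), 0 ≤ s →
      (‖fun b : T => (U *ᵥ x) b‖ ≤ s ↔ ∀ b : Fin d, b₀ ≤ b → |(U *ᵥ x) b| ≤ s) := by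
    intro x s hs
    rw [pi_norm_le_iff_of_nonneg hs]
    exact ⟨fun h b hb => h ⟨b, hb⟩, fun h b => h b b.2⟩
  have hball : ∀ {x : Fin d → ℝ}, x ⬝ᵥ x ≤ 4 → ∀ b, |(U *ᵥ x) b| ≤ 2 := fun {x} hx b =>
    abs_apply_le_two (by rwa [mulVec_dotProduct_self hU]) b
  have hcont : Continuous fun x : Fin d → ℝ => (fun b : T => (U *ᵥ x) b) :=
    continuous_pi fun b => (continuous_apply (b : Fin d)).comp
      (Continuous.matrix_mulVec continuous_const continuous_id)
  refine ⟨fun x => ‖fun b : T => (U *ᵥ x) b‖, hcont.norm.measurable, fun x => norm_nonneg _,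
    ?_, ?_, ?_⟩
  · refine (ae_restrict_iff' (measurableSet_dotProduct_le d 4)).2 (Filter.Eventually.of_forall ?_)
    exact fun x hx => (hNle x 2 (by norm_num)).2 fun b _ => hball hx b
  · intro s hs
    let r : Fin d → ℝ := fun b => if b₀ ≤ b then s else 2
    have hsub : {x | ‖fun b : T => (U *ᵥ x) b‖ ≤ s} ∩ {x : Fin d → ℝ | x ⬝ᵥ x ≤ 4} ⊆
        (fun x => U *ᵥ x) ⁻¹' Set.Icc (-r) r := by
      rintro x ⟨hx1, hx2⟩
      have h : ∀ b, |(U *ᵥ x) b| ≤ r b := by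
        intro b
        by_cases hb : b₀ ≤ b
        · simpa [r, hb] using (hNle x s hs.le).1 hx1 b hb
        · simpa [r, hb] using hball hx2 b
      exact ⟨fun b => (abs_le.1 (h b)).1, fun b => (abs_le.1 (h b)).2⟩
    rw [ballMeasure, Measure.restrict_apply
      (measurableSet_le hcont.norm.measurable measurable_const)]
    refine (measure_mono hsub).trans ?_
    rw [(measurePreserving_orthogonal_mulVec hU).measure_preimage
      measurableSet_Icc.nullMeasurableSet, Real.volume_Icc_pi]
    rw [← ENNReal.ofReal_prod_of_nonneg]
    · refine ENNReal.ofReal_le_ofReal ?_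
      have hcard : (Finset.univ.filter fun b : Fin d => b₀ ≤ (b : ℕ)).card = S.card - p := by
        have h1 : (Finset.univ.filter fun b : Fin d => b₀ ≤ (b : ℕ)) =
            Finset.Ici ⟨b₀, by omega⟩ := by
          ext b; simp [Fin.le_def]
        rw [h1, Fin.card_Ici]
        simp only [hb₀]
        omega
      have hle : ∀ b, r b - (-r) b ≤ 4 * if b₀ ≤ (b : ℕ) then s else 1 := by
        intro b
        simp only [r, Pi.neg_apply]
        split_ifs <;> linarith
      calc ∏ b, (r b - (-r) b) ≤ ∏ b : Fin d, (4 * if b₀ ≤ (b : ℕ) then s else 1) := by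
            refine Finset.prod_le_prod (fun b _ => ?_) fun b _ => hle b
            simp only [r, Pi.neg_apply]
            split_ifs <;> linarith
        _ = 4 ^ d * s ^ ((S.card : ℝ) - p) := by
            rw [Finset.prod_mul_distrib, Finset.prod_ite]
            simp only [Finset.prod_const, hcard, Finset.card_univ, Fintype.card_fin, one_pow,
              mul_one]
            rw [← Nat.cast_sub hp.le, Real.rpow_natCast]
    · intro b _
      simp only [r, Pi.neg_apply]
      split_ifs <;> linarith
  · intro x
    have hcons : (fun a => coordProj S ((Fin.cons x y : Fin (p + 1) → Fin d → ℝ) a))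
        = Fin.cons (coordProj S x) (fun a => coordProj S (y a)) := by
      funext a
      refine Fin.cases ?_ (fun a => ?_) a <;> simp
    rw [hcons, mul_comm, ← abs_of_nonneg (wedgeNorm_nonneg (fun a => coordProj S (y a))),
      ← Real.norm_eq_abs, ← norm_smul]
    refine (pi_norm_le_iff_of_nonneg (wedgeNorm_nonneg _)).2 fun b => ?_
    rw [Pi.smul_apply, norm_smul, Real.norm_eq_abs, Real.norm_eq_abs,
      abs_of_nonneg (wedgeNorm_nonneg _), mul_comm]
    have h := abs_mul_wedgeNorm_le_wedgeNorm_cons (fun a => coordProj S (y a)) (coordProj S x)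
      (U b) (hUU b) (hUy b b.2)
    rwa [hUP b b.2] at h

end Transverse

section GramIntegrals

open scoped ENNReal Matrix

lemma lintegral_pi_succ {α : Type*} [MeasurableSpace α] (ρ : Measure α) [SigmaFinite ρ] {p : ℕ}
    {F : (Fin (p + 1) → α) → ℝ≥0∞} (hF : Measurable F) :
    ∫⁻ x, F x ∂Measure.pi (fun _ => ρ)
      = ∫⁻ y, ∫⁻ x, F (Fin.cons x y) ∂ρ ∂Measure.pi (fun _ : Fin p => ρ) := by
  have h := (measurePreserving_piFinSuccAbove (fun _ : Fin (p + 1) => ρ) 0).symm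
  rw [← h.lintegral_comp hF,
    lintegral_prod_symm (fun z => F ((MeasurableEquiv.piFinSuccAbove (fun _ => α) 0).symm z))
      (hF.comp (MeasurableEquiv.measurable _)).aemeasurable]
  simp [MeasurableEquiv.piFinSuccAbove_symm_apply, Fin.insertNthEquiv]

lemma measurable_wedgeNorm_coordProj {d p : ℕ} (S : Finset (Fin d)) :
    Measurable fun x : Fin p → Fin d → ℝ => wedgeNorm (fun a => coordProj S (x a)) :=
  (continuous_wedgeNorm.comp (continuous_pi fun a =>
    (continuous_coordProj S).comp (continuous_apply a))).measurable

lemma exists_wedgeNorm_le (d p : ℕ) :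
    ∃ K : ℝ, 0 < K ∧ ∀ x : Fin p → Fin d → ℝ, (∀ a j, |x a j| ≤ 2) → wedgeNorm x ≤ K := by
  refine ⟨√(p.factorial * (d * 4 + 1) ^ p), Real.sqrt_pos.2 (by positivity), fun x hx => ?_⟩
  refine Real.sqrt_le_sqrt ((le_abs_self _).trans ?_)
  have h := Matrix.det_le (abv := AbsoluteValue.abs) (x := (d * 4 + 1 : ℝ))
    (A := Matrix.of fun a b : Fin p => ∑ j, x a j * x b j) (fun a b => ?_)
  · simpa using h
  · simp only [Matrix.of_apply, AbsoluteValue.abs_apply]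
    refine (Finset.abs_sum_le_sum_abs _ _).trans ?_
    refine (Finset.sum_le_card_nsmul _ _ 4 fun j _ => ?_).trans (by simp)
    rw [abs_mul]
    nlinarith [hx a j, hx b j, abs_nonneg (x a j), abs_nonneg (x b j)]

lemma ae_pi_ballMeasure (d p : ℕ) :
    ∀ᵐ x ∂Measure.pi (fun _ : Fin p => ballMeasure d), ∀ a, x a ⬝ᵥ x a ≤ 4 := by
  simp only [ballMeasure]
  rw [← Measure.restrict_pi_pi, ae_restrict_iff'
    (MeasurableSet.univ_pi fun _ => measurableSet_dotProduct_le d 4)]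
  exact Filter.Eventually.of_forall fun x hx a => hx a (Set.mem_univ a)

lemma abs_coordProj_le {d : ℕ} (S : Finset (Fin d)) (x : Fin d → ℝ) (j : Fin d) :
    |coordProj S x j| ≤ |x j| := by
  unfold coordProj
  split_ifs
  · exact le_rfl
  · simp

lemma lintegral_wedgeNorm_coordProj_ne_top {d : ℕ} (S : Finset (Fin d)) {β : ℝ} (hβ : 0 ≤ β)
    (p : ℕ) (hp : p ≤ S.card) (hβp : β < S.card - p + 1) :
    ∫⁻ x, ENNReal.ofReal (wedgeNorm (fun a => coordProj S (x a))) ^ (-β)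
      ∂Measure.pi (fun _ : Fin p => ballMeasure d) ≠ ∞ := by
  induction p with
  | zero =>
    have : ∀ x : Fin 0 → Fin d → ℝ, wedgeNorm (fun a => coordProj S (x a)) = 1 := by
      intro x
      simp [wedgeNorm_eq]
    simp [this]
  | succ p ih =>
    push_cast at hβp
    have ih := ih (by omega) (by linarith)
    have hK := tsum_layer_ne_top (R := 2) (C := 4 ^ d) (q := (S.card : ℝ) - p) (β := β)
      (by linarith)
    set K := ∑' l : ℕ, ENNReal.ofReal (4 ^ d * 2 ^ ((S.card : ℝ) - p - β) * Real.exp β *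
      Real.exp (-((S.card : ℝ) - p - β)) ^ l) with hKdef
    have hle : ∫⁻ x, ENNReal.ofReal (wedgeNorm (fun a => coordProj S (x a))) ^ (-β)
        ∂Measure.pi (fun _ : Fin (p + 1) => ballMeasure d) ≤
        ∫⁻ y, ENNReal.ofReal (wedgeNorm (fun a => coordProj S (y a))) ^ (-β) * K
          ∂Measure.pi (fun _ : Fin p => ballMeasure d) := by
      rw [lintegral_pi_succ _ ((measurable_wedgeNorm_coordProj S).ennreal_ofReal.pow_const _)]
      refine lintegral_mono fun y => ?_
      obtain ⟨N, hN, hN0, hN2, hNs, hNw⟩ := exists_transverse_norm S (p := p) (by omega) y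
      calc _ ≤ ∫⁻ x, ENNReal.ofReal (wedgeNorm (fun a => coordProj S (y a))) ^ (-β) *
            ENNReal.ofReal (N x) ^ (-β) ∂ballMeasure d := by
            refine lintegral_mono fun x => ?_
            rw [← ENNReal.mul_rpow_of_ne_top ENNReal.ofReal_ne_top ENNReal.ofReal_ne_top,
              ← ENNReal.ofReal_mul (wedgeNorm_nonneg _), mul_comm]
            exact ENNReal.rpow_neg_le_rpow_neg hβ (ENNReal.ofReal_le_ofReal (hNw x))
        _ ≤ _ := by
            rw [lintegral_const_mul _ (hN.ennreal_ofReal.pow_const _)]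
            gcongr
            exact lintegral_rpow_neg_le_tsum (by norm_num) hβ hN hN0 hN2 hNs
    refine ne_top_of_le_ne_top ?_ hle
    rw [lintegral_mul_const _ ((measurable_wedgeNorm_coordProj S).ennreal_ofReal.pow_const _)]
    exact ENNReal.mul_ne_top ih hK

/-- In the critical range the truncated integral grows at most linearly in the number of scales. -/
lemma exists_lintegral_max_wedgeNorm_coordProj_le {d : ℕ} (S : Finset (Fin d)) {β : ℝ}
    (hβ : 0 ≤ β) (p : ℕ) (hp : p < S.card) (hβp : β ≤ S.card - p) :
    ∃ C : ℝ, 0 < C ∧ ∃ K : ℝ, 0 < K ∧ ∀ L : ℕ,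
      ∫⁻ x, ENNReal.ofReal (max (wedgeNorm (fun a => coordProj S (x a)))
          (K * Real.exp (-((L : ℝ) + 1)))) ^ (-β)
        ∂Measure.pi (fun _ : Fin (p + 1) => ballMeasure d) ≤ ENNReal.ofReal (C * (L + 1)) := by
  obtain ⟨K, hK, hKle⟩ := exists_wedgeNorm_le d p
  have hJ := lintegral_wedgeNorm_coordProj_ne_top S hβ p hp.le (by linarith)
  set J := ∫⁻ x, ENNReal.ofReal (wedgeNorm (fun a => coordProj S (x a))) ^ (-β)
      ∂Measure.pi (fun _ : Fin p => ballMeasure d) with hJdef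
  set M : ℝ := 4 ^ d * 2 ^ ((S.card : ℝ) - p - β) * Real.exp β with hM
  have hM0 : 0 < M := by positivity
  obtain ⟨j, hj, hJj⟩ : ∃ j : ℝ, 0 ≤ j ∧ J = ENNReal.ofReal j :=
    ⟨J.toReal, ENNReal.toReal_nonneg, (ENNReal.ofReal_toReal hJ).symm⟩
  refine ⟨(j + 1) * M, by positivity, K * 2, by positivity, fun L => ?_⟩
  set ε : ℝ := 2 * Real.exp (-((L : ℝ) + 1)) with hε
  have hle : ∫⁻ x, ENNReal.ofReal (max (wedgeNorm (fun a => coordProj S (x a)))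
          (K * 2 * Real.exp (-((L : ℝ) + 1)))) ^ (-β)
        ∂Measure.pi (fun _ : Fin (p + 1) => ballMeasure d) ≤
      ∫⁻ y, ENNReal.ofReal (wedgeNorm (fun a => coordProj S (y a))) ^ (-β) *
        (((L + 1 : ℕ) : ℝ≥0∞) * ENNReal.ofReal M)
        ∂Measure.pi (fun _ : Fin p => ballMeasure d) := by
    rw [lintegral_pi_succ _ (((measurable_wedgeNorm_coordProj S).max
      measurable_const).ennreal_ofReal.pow_const _)]
    refine lintegral_mono_ae ?_
    filter_upwards [ae_pi_ballMeasure d p] with y hy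
    have hyK : wedgeNorm (fun a => coordProj S (y a)) ≤ K := hKle _ fun a j =>
      (abs_coordProj_le S (y a) j).trans (abs_apply_le_two (hy a) j)
    obtain ⟨N, hN, hN0, hN2, hNs, hNw⟩ := exists_transverse_norm S hp y
    calc _ ≤ ∫⁻ x, ENNReal.ofReal (wedgeNorm (fun a => coordProj S (y a))) ^ (-β) *
          ENNReal.ofReal (max (N x) ε) ^ (-β) ∂ballMeasure d := by
          refine lintegral_mono fun x => ?_
          rw [← ENNReal.mul_rpow_of_ne_top ENNReal.ofReal_ne_top ENNReal.ofReal_ne_top,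
            ← ENNReal.ofReal_mul (wedgeNorm_nonneg _)]
          refine ENNReal.rpow_neg_le_rpow_neg hβ (ENNReal.ofReal_le_ofReal ?_)
          rw [mul_comm, max_mul_of_nonneg _ _ (wedgeNorm_nonneg _)]
          refine max_le_max (hNw x) ?_
          rw [hε, mul_comm, mul_assoc K]
          exact mul_le_mul_of_nonneg_right hyK (by positivity)
      _ ≤ _ := by
          rw [lintegral_const_mul _ ((hN.max measurable_const).ennreal_ofReal.pow_const _)]
          gcongr
          exact lintegral_max_rpow_neg_le (by norm_num) hβ hβp hN hN2 (by positivity) hNs L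
  refine hle.trans ?_
  rw [lintegral_mul_const _ ((measurable_wedgeNorm_coordProj S).ennreal_ofReal.pow_const _),
    ← hJdef, hJj, ← ENNReal.ofReal_natCast,
    ← ENNReal.ofReal_mul (by positivity), ← ENNReal.ofReal_mul (by positivity)]
  refine ENNReal.ofReal_le_ofReal ?_
  push_cast
  have : 0 ≤ M * ((L : ℝ) + 1) := by positivity
  nlinarith

end GramIntegrals

section Averaging

open scoped ENNReal Matrix

/-- The diagonal matrix with entries `e^{bt}` on `S` and `e^{-at}` off `S`, where `a = #S` and
`b = d - #S`. -/
noncomputable def coordFlow {d : ℕ} (S : Finset (Fin d)) (t : ℝ) : Matrix (Fin d) (Fin d) ℝ :=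
  Matrix.diagonal fun j =>
    if j ∈ S then Real.exp ((Sᶜ.card : ℝ) * t) else Real.exp (-((S.card : ℝ) * t))

lemma measurable_mulVec_specialOrthogonal {d i : ℕ} :
    Measurable fun z : Matrix.specialOrthogonalGroup (Fin d) ℝ × (Fin i → Fin d → ℝ) =>
      fun a => (z.1 : Matrix (Fin d) (Fin d) ℝ) *ᵥ z.2 a := by
  refine measurable_pi_iff.2 fun a => measurable_pi_iff.2 fun j => ?_
  simp only [Matrix.mulVec, dotProduct]
  refine Finset.measurable_sum _ fun l _ => ?_
  refine ((measurable_specialOrthogonal_entry j l).comp measurable_fst).mul ?_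
  exact (measurable_pi_apply l).comp ((measurable_pi_apply a).comp measurable_snd)

lemma measurable_wedgeNorm_mulVec {d i : ℕ} (A : Matrix (Fin d) (Fin d) ℝ) :
    Measurable fun x : Fin i → Fin d → ℝ => wedgeNorm (fun a => A *ᵥ x a) :=
  (continuous_wedgeNorm.comp (continuous_pi fun a =>
    Continuous.matrix_mulVec continuous_const (continuous_apply a))).measurable

/-- Every tuple of `i ≤ d` vectors is a linear combination of the first `i` rows of a rotation. -/
lemma exists_specialOrthogonal_frame {d i : ℕ} (hi : i ≤ d) (v : Fin i → Fin d → ℝ) :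
    ∃ U ∈ Matrix.specialOrthogonalGroup (Fin d) ℝ, ∃ R : Matrix (Fin i) (Fin i) ℝ,
      ∀ a, v a = ∑ b, R a b • U (Fin.castLE hi b) := by
  let X : Fin d → Fin d → ℝ := fun a => if h : (a : ℕ) < i then v ⟨a, h⟩ else 0
  obtain ⟨U, hU, hUX⟩ := exists_specialOrthogonal_triangular X
  have hUU : Uᵀ * U = 1 :=
    (Matrix.mem_orthogonalGroup_iff' (Fin d) ℝ).1 (Matrix.mem_specialOrthogonalGroup_iff.1 hU).1
  refine ⟨U, hU, Matrix.of fun a b => U (Fin.castLE hi b) ⬝ᵥ v a, fun a => ?_⟩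
  have h1 : v a = Uᵀ *ᵥ (U *ᵥ v a) := by
    rw [Matrix.mulVec_mulVec, hUU, Matrix.one_mulVec]
  have h2 : ∀ b : Fin d, i ≤ b → (U *ᵥ v a) b = 0 := by
    intro b hb
    have ha := a.2
    have h := hUX (Fin.castLE hi a) b (Fin.lt_def.2 (by simp; omega))
    have h' : U b ⬝ᵥ v a = 0 := by simpa [X] using h
    exact h'
  obtain ⟨e, rfl⟩ := Nat.exists_eq_add_of_le hi
  ext j
  conv_lhs => rw [h1]
  simp only [Matrix.mulVec, dotProduct] at h2 ⊢
  rw [Fin.sum_univ_add]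
  simp only [Finset.sum_apply, Pi.smul_apply, smul_eq_mul, Matrix.of_apply, Matrix.transpose_apply]
  rw [Finset.sum_eq_zero (s := (Finset.univ : Finset (Fin e))) fun b _ => by
    rw [h2 _ (by simp), mul_zero], add_zero]
  refine Finset.sum_congr rfl fun b _ => ?_
  rw [mul_comm]
  rfl

lemma measurePreserving_ballMeasure {d : ℕ} {A : Matrix (Fin d) (Fin d) ℝ}
    (hA : A ∈ Matrix.orthogonalGroup (Fin d) ℝ) :
    MeasurePreserving (fun x : Fin d → ℝ => A *ᵥ x) (ballMeasure d) (ballMeasure d) := by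
  have h := (measurePreserving_orthogonal_mulVec hA).restrict_preimage
    (measurableSet_dotProduct_le d 4)
  have hpre : (fun x : Fin d → ℝ => A *ᵥ x) ⁻¹' {x | x ⬝ᵥ x ≤ 4} = {x | x ⬝ᵥ x ≤ 4} := by
    ext x
    simp [mulVec_dotProduct_self hA]
  rwa [hpre] at h

lemma wedgeNorm_single {d i : ℕ} (f : Fin i → Fin d) (hf : Function.Injective f) :
    wedgeNorm (fun a => (Pi.single (f a) 1 : Fin d → ℝ)) = 1 := by
  have h : (Matrix.of fun a b : Fin i => ∑ j, (Pi.single (f a) (1 : ℝ) : Fin d → ℝ) j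
      * (Pi.single (f b) (1 : ℝ) : Fin d → ℝ) j) = 1 := by
    ext a b
    simp [Pi.single_apply, Matrix.one_apply, hf.eq_iff, eq_comm]
  rw [wedgeNorm, h, Matrix.det_one, Real.sqrt_one]

lemma pi_ballMeasure_wedgeNorm_pos {d i : ℕ} (hi : i ≤ d) :
    0 < Measure.pi (fun _ : Fin i => ballMeasure d) {x | 1 / 2 ≤ wedgeNorm x} := by
  simp only [ballMeasure]
  rw [← Measure.restrict_pi_pi, Measure.restrict_apply
    (measurableSet_le measurable_const measurable_wedgeNorm)]
  let O : Set (Fin i → Fin d → ℝ) := {x | 1 / 2 < wedgeNorm x} ∩ ⋂ a, {x | x a ⬝ᵥ x a < 4}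
  have hO : IsOpen O := by
    refine (isOpen_lt continuous_const continuous_wedgeNorm).inter
      (isOpen_iInter_of_finite fun a => isOpen_lt ?_ continuous_const)
    unfold dotProduct
    fun_prop
  have hne : O.Nonempty := by
    refine ⟨fun a => Pi.single (Fin.castLE hi a) 1, ?_, ?_⟩
    · simp only [Set.mem_ofPred_eq, wedgeNorm_single _ (Fin.castLE_injective hi)]
      norm_num
    · simp
  refine (hO.measure_pos volume hne).trans_le (measure_mono ?_)
  rintro x ⟨h1, h2⟩
  refine ⟨(show 1 / 2 < wedgeNorm x from h1).le, fun a _ => ?_⟩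
  exact (show x a ⬝ᵥ x a < 4 from Set.mem_iInter.1 h2 a).le

lemma wedgeNorm_coordFlow_ge {d i : ℕ} (S : Finset (Fin d)) {t : ℝ} (ht : 0 ≤ t)
    (x : Fin i → Fin d → ℝ)
    (hx : 1 / 2 ≤ wedgeNorm x) :
    Real.exp (Sᶜ.card * t) ^ i * max (wedgeNorm fun a => coordProj S (x a))
      (1 / 2 * Real.exp (-(d * i * t))) ≤ wedgeNorm (fun a => coordFlow S t *ᵥ x a) := by
  have hcard : (S.card : ℝ) + Sᶜ.card = d := by
    exact_mod_cast (Finset.card_add_card_compl S).trans (Fintype.card_fin d)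
  set f : Fin d → ℝ := fun j =>
    if j ∈ S then Real.exp ((Sᶜ.card : ℝ) * t) else Real.exp (-((S.card : ℝ) * t)) with hf
  have hflow : (fun a => coordFlow S t *ᵥ x a) = fun a j => f j * x a j := by
    ext a j
    rw [coordFlow, Matrix.mulVec_diagonal]
  rw [hflow, mul_max_of_nonneg _ _ (by positivity)]
  refine max_le ?_ ?_
  · rw [← wedgeNorm_smul _ (Real.exp_pos _).le]
    have h : (fun (a : Fin i) j => Real.exp (Sᶜ.card * t) * coordProj S (x a) j)
        = fun a j => (if j ∈ S then Real.exp (Sᶜ.card * t) else 0) * x a j := by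
      ext a j
      simp [coordProj]
    rw [h]
    refine wedgeNorm_mono_diagonal x _ _ fun j => ?_
    simp only [hf]
    split_ifs
    · exact le_rfl
    · simpa using sq_nonneg (Real.exp (-((S.card : ℝ) * t)))
  · refine le_trans ?_ (wedgeNorm_mono_diagonal x (fun _ => Real.exp (-((S.card : ℝ) * t))) f ?_)
    · rw [wedgeNorm_smul _ (Real.exp_pos _).le, ← Real.exp_nat_mul, ← Real.exp_nat_mul,
        mul_left_comm, ← Real.exp_add, mul_comm]
      have : (i : ℝ) * (Sᶜ.card * t) + -(d * i * t) = i * -(S.card * t) := by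
        rw [← hcard]; ring
      rw [this]
      gcongr
    · intro j
      refine pow_le_pow_left₀ (Real.exp_pos _).le ?_ 2
      simp only [hf]
      split_ifs
      · rw [Real.exp_le_exp]
        have h1 : 0 ≤ (S.card : ℝ) * t := by positivity
        have h2 : 0 ≤ (Sᶜ.card : ℝ) * t := by positivity
        linarith
      · exact le_rfl

lemma transpose_mem_orthogonalGroup {d : ℕ} {O : Matrix (Fin d) (Fin d) ℝ}
    (hO : O ∈ Matrix.orthogonalGroup (Fin d) ℝ) : Oᵀ ∈ Matrix.orthogonalGroup (Fin d) ℝ := by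
  rw [Matrix.mem_orthogonalGroup_iff, Matrix.transpose_transpose]
  exact (Matrix.mem_orthogonalGroup_iff' (Fin d) ℝ).1 hO

lemma wedgeNorm_orthogonal_rows {d i : ℕ} {O : Matrix (Fin d) (Fin d) ℝ}
    (hO : O ∈ Matrix.orthogonalGroup (Fin d) ℝ) (f : Fin i → Fin d) (hf : Function.Injective f) :
    wedgeNorm (fun a => O (f a)) = 1 := by
  have hrow : (fun a => O (f a)) = fun a => Oᵀ *ᵥ (Pi.single (f a) 1 : Fin d → ℝ) := by
    ext a j
    simp
  rw [hrow, wedgeNorm_mulVec_orthogonal (transpose_mem_orthogonalGroup hO), wedgeNorm_single f hf]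

lemma lintegral_rpow_wedgeNorm_eq_mul {d i : ℕ} (hi : i ≤ d) (A : Matrix (Fin d) (Fin d) ℝ)
    (μ : Measure (Matrix.specialOrthogonalGroup (Fin d) ℝ)) [IsProbabilityMeasure μ]
    (hμ : ∀ k₀ : Matrix.specialOrthogonalGroup (Fin d) ℝ, μ.map (fun k => k₀ * k) = μ)
    (β : ℝ) (w : Fin i → Fin d → ℝ) :
    ∫⁻ k, ENNReal.ofReal (wedgeNorm fun a =>
        A *ᵥ ((k : Matrix (Fin d) (Fin d) ℝ) *ᵥ w a)) ^ (-β) ∂μ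
      = ENNReal.ofReal (wedgeNorm w) ^ (-β) *
        ∫⁻ k, ENNReal.ofReal (wedgeNorm fun a : Fin i =>
          A *ᵥ ((k : Matrix (Fin d) (Fin d) ℝ) *ᵥ Pi.single (Fin.castLE hi a) 1)) ^ (-β) ∂μ := by
  obtain ⟨U, hU, R, hR⟩ := exists_specialOrthogonal_frame hi w
  have hUO := (Matrix.mem_specialOrthogonalGroup_iff.1 hU).1
  have hrow : ∀ b, U b = Uᵀ *ᵥ Pi.single b 1 := by
    intro b
    ext j
    simp
  have hw : wedgeNorm w = |R.det| := by
    rw [show w = fun a => ∑ b, R a b • U (Fin.castLE hi b) from funext hR, wedgeNorm_linearComb,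
      wedgeNorm_orthogonal_rows hUO _ (Fin.castLE_injective hi), mul_one]
  set k₀ : Matrix.specialOrthogonalGroup (Fin d) ℝ := ⟨U, hU⟩⁻¹ with hk₀
  have hk : ∀ k : Matrix.specialOrthogonalGroup (Fin d) ℝ,
      wedgeNorm (fun a => A *ᵥ ((k : Matrix (Fin d) (Fin d) ℝ) *ᵥ w a))
        = |R.det| * wedgeNorm (fun a : Fin i =>
          A *ᵥ (((k * k₀ : Matrix.specialOrthogonalGroup (Fin d) ℝ) :
            Matrix (Fin d) (Fin d) ℝ) *ᵥ Pi.single (Fin.castLE hi a) 1)) := by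
    intro k
    rw [← wedgeNorm_linearComb]
    congr 1
    ext1 a
    rw [hR a, Matrix.mulVec_sum, Matrix.mulVec_sum]
    refine Finset.sum_congr rfl fun b _ => ?_
    rw [Matrix.mulVec_smul, Matrix.mulVec_smul, hrow, Submonoid.coe_mul, hk₀,
      coe_specialOrthogonal_inv, ← Matrix.mulVec_mulVec]
  have hmeas : Measurable fun k : Matrix.specialOrthogonalGroup (Fin d) ℝ =>
      ENNReal.ofReal (wedgeNorm fun a : Fin i =>
        A *ᵥ ((k : Matrix (Fin d) (Fin d) ℝ) *ᵥ Pi.single (Fin.castLE hi a) 1)) ^ (-β) := by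
    refine (ENNReal.measurable_ofReal.comp ((measurable_wedgeNorm_mulVec A).comp
      (measurable_mulVec_specialOrthogonal.comp
        (measurable_id.prodMk (measurable_const
          (a := fun a : Fin i => (Pi.single (Fin.castLE hi a) 1 : Fin d → ℝ))))))).pow_const _
  rw [← lintegral_mul_right_of_map_mul_left hμ hmeas k₀, hw, ← lintegral_const_mul]
  · refine lintegral_congr fun k => ?_
    rw [hk k, ENNReal.ofReal_mul (abs_nonneg _),
      ENNReal.mul_rpow_of_ne_top ENNReal.ofReal_ne_top ENNReal.ofReal_ne_top]
  · exact hmeas.comp (measurable_mul_const k₀)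

lemma measure_mul_lintegral_wedgeNorm_single_le {d i : ℕ} (hi : i ≤ d)
    (A : Matrix (Fin d) (Fin d) ℝ)
    (μ : Measure (Matrix.specialOrthogonalGroup (Fin d) ℝ)) [IsProbabilityMeasure μ]
    (hμ : ∀ k₀ : Matrix.specialOrthogonalGroup (Fin d) ℝ, μ.map (fun k => k₀ * k) = μ)
    {β K : ℝ} (hβ : 0 ≤ β)
    (hK : ∀ x : Fin i → Fin d → ℝ, (∀ a j, |x a j| ≤ 2) → wedgeNorm x ≤ K) :
    ENNReal.ofReal K ^ (-β) * (∫⁻ k, ENNReal.ofReal (wedgeNorm fun a : Fin i =>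
          A *ᵥ ((k : Matrix (Fin d) (Fin d) ℝ) *ᵥ Pi.single (Fin.castLE hi a) 1)) ^ (-β) ∂μ) *
        Measure.pi (fun _ : Fin i => ballMeasure d) {x | 1 / 2 ≤ wedgeNorm x}
      ≤ ∫⁻ x in {x : Fin i → Fin d → ℝ | 1 / 2 ≤ wedgeNorm x},
          ENNReal.ofReal (wedgeNorm fun a => A *ᵥ x a) ^ (-β)
          ∂Measure.pi (fun _ : Fin i => ballMeasure d) := by
  set lam := Measure.pi (fun _ : Fin i => ballMeasure d) with hlam
  set E : Set (Fin i → Fin d → ℝ) := {x | 1 / 2 ≤ wedgeNorm x} with hE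
  have hEm : MeasurableSet E := measurableSet_le measurable_const measurable_wedgeNorm
  have hΦ : Measurable fun x : Fin i → Fin d → ℝ =>
      ENNReal.ofReal (wedgeNorm fun a => A *ᵥ x a) ^ (-β) :=
    (ENNReal.measurable_ofReal.comp (measurable_wedgeNorm_mulVec A)).pow_const _
  have hinv : ∀ k : Matrix.specialOrthogonalGroup (Fin d) ℝ,
      ∫⁻ x in E, ENNReal.ofReal (wedgeNorm fun a => A *ᵥ x a) ^ (-β) ∂lam
        = ∫⁻ x in E, ENNReal.ofReal (wedgeNorm fun a =>
            A *ᵥ ((k : Matrix (Fin d) (Fin d) ℝ) *ᵥ x a)) ^ (-β) ∂lam := by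
    intro k
    have hk := (Matrix.mem_specialOrthogonalGroup_iff.1 k.2).1
    have hmp : MeasurePreserving (fun (x : Fin i → Fin d → ℝ) a =>
        (k : Matrix (Fin d) (Fin d) ℝ) *ᵥ x a) lam lam :=
      measurePreserving_pi _ _ fun _ => measurePreserving_ballMeasure hk
    have h := hmp.restrict_preimage hEm
    have hpre : (fun (x : Fin i → Fin d → ℝ) a =>
        (k : Matrix (Fin d) (Fin d) ℝ) *ᵥ x a) ⁻¹' E = E := by
      ext x
      simp only [hE, Set.mem_preimage, Set.mem_ofPred_eq, wedgeNorm_mulVec_orthogonal hk]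
    rw [hpre] at h
    exact (h.lintegral_comp hΦ).symm
  have hswap : ∫⁻ x in E, ENNReal.ofReal (wedgeNorm fun a => A *ᵥ x a) ^ (-β) ∂lam
      = ∫⁻ x in E, ∫⁻ k, ENNReal.ofReal (wedgeNorm fun a =>
            A *ᵥ ((k : Matrix (Fin d) (Fin d) ℝ) *ᵥ x a)) ^ (-β) ∂μ ∂lam := by
    have hjoint : AEMeasurable (Function.uncurry fun
        (k : Matrix.specialOrthogonalGroup (Fin d) ℝ) (x : Fin i → Fin d → ℝ) =>
        ENNReal.ofReal (wedgeNorm fun a => A *ᵥ ((k : Matrix (Fin d) (Fin d) ℝ) *ᵥ x a)) ^ (-β))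
        (μ.prod (lam.restrict E)) :=
      (hΦ.comp measurable_mulVec_specialOrthogonal).aemeasurable
    rw [← lintegral_lintegral_swap hjoint]
    calc _ = ∫⁻ _k, (∫⁻ x in E, ENNReal.ofReal (wedgeNorm fun a => A *ᵥ x a) ^ (-β) ∂lam) ∂μ := by
          simp
      _ = _ := lintegral_congr fun k => hinv k
  rw [hswap, ← setLIntegral_const]
  refine lintegral_mono_ae ?_
  filter_upwards [ae_restrict_of_ae (ae_pi_ballMeasure d i)] with x hx
  rw [lintegral_rpow_wedgeNorm_eq_mul hi A μ hμ β x]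
  refine mul_le_mul_left ?_ _
  exact ENNReal.rpow_neg_le_rpow_neg hβ
    (ENNReal.ofReal_le_ofReal (hK x fun a => abs_apply_le_two (hx a)))

/-- The averaged bound for the flow expanding the coordinates in `S`. -/
theorem exists_lintegral_coordFlow_le {d p : ℕ} (S : Finset (Fin d)) (hp : p + 1 ≤ S.card) :
    ∃ c : ℝ, 0 < c ∧ ∀ (μ : Measure (Matrix.specialOrthogonalGroup (Fin d) ℝ)),
      IsProbabilityMeasure μ →
      (∀ k₀ : Matrix.specialOrthogonalGroup (Fin d) ℝ, μ.map (fun k => k₀ * k) = μ) →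
      ∀ t : ℝ, 1 ≤ t → ∀ w : Fin (p + 1) → Fin d → ℝ,
        ∫⁻ k, ENNReal.ofReal (wedgeNorm fun a =>
            coordFlow S t *ᵥ ((k : Matrix (Fin d) (Fin d) ℝ) *ᵥ w a))
              ^ (-((S.card : ℝ) / ((p + 1 : ℕ) : ℝ))) ∂μ
          ≤ ENNReal.ofReal (c * t * Real.exp (-((S.card : ℝ) * Sᶜ.card * t))) *
            ENNReal.ofReal (wedgeNorm w) ^ (-((S.card : ℝ) / ((p + 1 : ℕ) : ℝ))) := by
  have hpd : p + 1 ≤ d := hp.trans ((Finset.card_le_univ S).trans_eq (Fintype.card_fin d))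
  set β : ℝ := (S.card : ℝ) / ((p + 1 : ℕ) : ℝ) with hβdef
  have hp1 : (0 : ℝ) < ((p + 1 : ℕ) : ℝ) := by positivity
  have hpR : (p : ℝ) + 1 ≤ S.card := by exact_mod_cast hp
  have hβ : 0 ≤ β := by positivity
  have hβp : β ≤ S.card - p := by
    rw [hβdef, div_le_iff₀ hp1]
    push_cast
    nlinarith [mul_nonneg (Nat.cast_nonneg (α := ℝ) p) (sub_nonneg.2 hpR)]
  obtain ⟨C, hC, K', hK', hbound⟩ :=
    exists_lintegral_max_wedgeNorm_coordProj_le S hβ p (by omega) hβp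
  obtain ⟨K, hK, hKle⟩ := exists_wedgeNorm_le d (p + 1)
  set lam := Measure.pi (fun _ : Fin (p + 1) => ballMeasure d) with hlam
  set E : Set (Fin (p + 1) → Fin d → ℝ) := {x | 1 / 2 ≤ wedgeNorm x} with hE
  have hEm : MeasurableSet E := measurableSet_le measurable_const measurable_wedgeNorm
  have hEpos : 0 < lam E := pi_ballMeasure_wedgeNorm_pos hpd
  have hEfin : lam E ≠ ⊤ := measure_ne_top _ _
  set q : ℝ≥0∞ := ENNReal.ofReal K ^ (-β) * lam E with hq
  have hKpow : ENNReal.ofReal K ^ (-β) = ENNReal.ofReal (K ^ (-β)) :=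
    ENNReal.ofReal_rpow_of_pos hK
  have hqfin : q ≠ ⊤ := by
    rw [hq, hKpow]
    exact ENNReal.mul_ne_top ENNReal.ofReal_ne_top hEfin
  have hq0 : q ≠ 0 := by
    rw [hq, hKpow]
    exact mul_ne_zero (by simpa using Real.rpow_pos_of_pos hK _) hEpos.ne'
  have hqr : 0 < q.toReal := ENNReal.toReal_pos hq0 hqfin
  set M : ℝ := (d : ℝ) * ((p + 1 : ℕ) : ℝ) + |Real.log (2 * K')| + 2 with hM
  have hMpos : 0 < M := by positivity
  refine ⟨C * M / q.toReal, by positivity, fun μ hprob hμ t ht w => ?_⟩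
  have ht0 : 0 ≤ t := by linarith
  rw [lintegral_rpow_wedgeNorm_eq_mul hpd _ μ hμ β w, mul_comm]
  gcongr
  set F := ∫⁻ k, ENNReal.ofReal (wedgeNorm fun a : Fin (p + 1) => coordFlow S t *ᵥ
    ((k : Matrix (Fin d) (Fin d) ℝ) *ᵥ Pi.single (Fin.castLE hpd a) 1)) ^ (-β) ∂μ with hF
  set L : ℕ := ⌈(d : ℝ) * ((p + 1 : ℕ) : ℝ) * t + |Real.log (2 * K')|⌉₊ with hL
  have hLge : (d : ℝ) * ((p + 1 : ℕ) : ℝ) * t + |Real.log (2 * K')| ≤ L := Nat.le_ceil _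
  have hLle : (L : ℝ) + 1 ≤ M * t := by
    have h := Nat.ceil_lt_add_one
      (show 0 ≤ (d : ℝ) * ((p + 1 : ℕ) : ℝ) * t + |Real.log (2 * K')| by positivity)
    rw [← hL] at h
    have h2 : |Real.log (2 * K')| ≤ |Real.log (2 * K')| * t :=
      le_mul_of_one_le_right (abs_nonneg _) ht
    rw [hM]
    nlinarith
  have hcut : K' * Real.exp (-((L : ℝ) + 1))
      ≤ 1 / 2 * Real.exp (-((d : ℝ) * ((p + 1 : ℕ) : ℝ) * t)) := by
    have h1 : 2 * K' ≤ Real.exp |Real.log (2 * K')| := by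
      conv_lhs => rw [← Real.exp_log (show 0 < 2 * K' by positivity)]
      exact Real.exp_le_exp.2 (le_abs_self _)
    have h2 : Real.exp |Real.log (2 * K')| * Real.exp (-((L : ℝ) + 1))
        ≤ Real.exp (-((d : ℝ) * ((p + 1 : ℕ) : ℝ) * t)) := by
      rw [← Real.exp_add]
      exact Real.exp_le_exp.2 (by linarith)
    nlinarith [mul_le_mul_of_nonneg_right h1 (Real.exp_pos (-((L : ℝ) + 1))).le]
  have hexp : ENNReal.ofReal (Real.exp (Sᶜ.card * t) ^ (p + 1)) ^ (-β)
      = ENNReal.ofReal (Real.exp (-((S.card : ℝ) * Sᶜ.card * t))) := by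
    rw [ENNReal.ofReal_rpow_of_pos (by positivity), ← Real.exp_nat_mul, ← Real.exp_mul]
    congr 2
    rw [hβdef]
    field_simp
  have hupper : ∫⁻ x in E, ENNReal.ofReal (wedgeNorm fun a => coordFlow S t *ᵥ x a) ^ (-β) ∂lam
      ≤ ENNReal.ofReal (Real.exp (-((S.card : ℝ) * Sᶜ.card * t))) *
        ENNReal.ofReal (C * (L + 1)) := by
    refine le_trans ?_ (mul_le_mul_right (hbound L) _)
    rw [← hexp, ← lintegral_const_mul' _ _ (by rw [hexp]; exact ENNReal.ofReal_ne_top)]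
    refine le_trans (setLIntegral_mono' hEm fun x hx => ?_) (setLIntegral_le_lintegral _ _)
    rw [← ENNReal.mul_rpow_of_ne_top ENNReal.ofReal_ne_top ENNReal.ofReal_ne_top,
      ← ENNReal.ofReal_mul (by positivity)]
    refine ENNReal.rpow_neg_le_rpow_neg hβ (ENNReal.ofReal_le_ofReal ?_)
    refine le_trans ?_ (wedgeNorm_coordFlow_ge S ht0 x hx)
    gcongr
  have hlower := measure_mul_lintegral_wedgeNorm_single_le hpd (coordFlow S t) μ hμ hβ hKle
  have hFq : F * q ≤ ENNReal.ofReal (Real.exp (-((S.card : ℝ) * Sᶜ.card * t))) *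
        ENNReal.ofReal (C * (L + 1)) := by
    refine le_trans (le_of_eq ?_) (hlower.trans hupper)
    rw [hq, hF]
    ring
  rw [← ENNReal.le_div_iff_mul_le (Or.inl hq0) (Or.inl hqfin)] at hFq
  refine hFq.trans ?_
  rw [← ENNReal.ofReal_mul (Real.exp_pos _).le]
  refine (ENNReal.div_le_of_le_mul ?_)
  rw [← ENNReal.ofReal_toReal hqfin, ENNReal.toReal_ofReal hqr.le,
    ← ENNReal.ofReal_mul (by positivity)]
  refine ENNReal.ofReal_le_ofReal ?_
  have : C * M / q.toReal * t * Real.exp (-((S.card : ℝ) * Sᶜ.card * t)) * q.toReal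
      = Real.exp (-((S.card : ℝ) * Sᶜ.card * t)) * (C * (M * t)) := by
    field_simp
  rw [this]
  gcongr

end Averaging

section Duality

open scoped ENNReal Matrix

/-- Jacobi's identity for complementary minors of a matrix and its inverse. -/
lemma det_toBlocks₁₁_eq_det_mul_det_toBlocks₂₂ {R p q : Type*} [CommRing R] [Fintype p] [Fintype q]
    [DecidableEq p] [DecidableEq q] {M N : Matrix (p ⊕ q) (p ⊕ q) R} (h : M * N = 1) :
    M.toBlocks₁₁.det = M.det * N.toBlocks₂₂.det := by
  have hblocks : Matrix.fromBlocks (M.toBlocks₁₁ * N.toBlocks₁₁ + M.toBlocks₁₂ * N.toBlocks₂₁)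
      (M.toBlocks₁₁ * N.toBlocks₁₂ + M.toBlocks₁₂ * N.toBlocks₂₂)
      (M.toBlocks₂₁ * N.toBlocks₁₁ + M.toBlocks₂₂ * N.toBlocks₂₁)
      (M.toBlocks₂₁ * N.toBlocks₁₂ + M.toBlocks₂₂ * N.toBlocks₂₂)
      = Matrix.fromBlocks (1 : Matrix p p R) 0 0 (1 : Matrix q q R) := by
    rw [← Matrix.fromBlocks_multiply, Matrix.fromBlocks_toBlocks, Matrix.fromBlocks_toBlocks, h,
      Matrix.fromBlocks_one]
  obtain ⟨-, h12, -, h22⟩ := Matrix.fromBlocks_inj.1 hblocks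
  have hmul : M * Matrix.fromBlocks 1 N.toBlocks₁₂ 0 N.toBlocks₂₂
      = Matrix.fromBlocks M.toBlocks₁₁ 0 M.toBlocks₂₁ 1 := by
    conv_lhs => rw [← Matrix.fromBlocks_toBlocks M]
    rw [Matrix.fromBlocks_multiply, h12, h22]
    simp
  have hdet := congrArg Matrix.det hmul
  rw [Matrix.det_mul, Matrix.det_fromBlocks_zero₂₁, Matrix.det_fromBlocks_zero₁₂, Matrix.det_one,
    Matrix.det_one, one_mul, mul_one] at hdet
  exact hdet.symm

/-- A unimodular diagonal matrix and its inverse expand complementary subsets of an orthonormal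
basis by the same factor. -/
lemma wedgeNorm_diagonal_mulVec_compl {d i j : ℕ} (e : Fin i ⊕ Fin j ≃ Fin d)
    {O : Matrix (Fin d) (Fin d) ℝ} (hO : O ∈ Matrix.orthogonalGroup (Fin d) ℝ)
    {f g : Fin d → ℝ} (hfg : ∀ l, f l * g l = 1) (hf : ∏ l, f l = 1) :
    wedgeNorm (fun a => Matrix.diagonal f *ᵥ O (e (Sum.inl a)))
      = wedgeNorm (fun b => Matrix.diagonal g *ᵥ O (e (Sum.inr b))) := by
  have hOO : O * Oᵀ = 1 := (Matrix.mem_orthogonalGroup_iff (Fin d) ℝ).1 hO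
  have hOO' : Oᵀ * O = 1 := (Matrix.mem_orthogonalGroup_iff' (Fin d) ℝ).1 hO
  set M : Matrix (Fin d) (Fin d) ℝ :=
    O * ((Matrix.diagonal f)ᵀ * Matrix.diagonal f) * Oᵀ with hM
  set N : Matrix (Fin d) (Fin d) ℝ :=
    O * ((Matrix.diagonal g)ᵀ * Matrix.diagonal g) * Oᵀ with hN
  have hMN : M * N = 1 := by
    have h1 : Matrix.diagonal f * Matrix.diagonal g = 1 := by
      rw [Matrix.diagonal_mul_diagonal, ← Matrix.diagonal_one]
      exact congrArg _ (funext hfg)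
    simp only [hM, hN, Matrix.diagonal_transpose]
    calc _ = O * (Matrix.diagonal f * (Matrix.diagonal f * (Oᵀ * O) * Matrix.diagonal g) *
          Matrix.diagonal g) * Oᵀ := by simp only [Matrix.mul_assoc]
      _ = 1 := by rw [hOO', Matrix.mul_one, h1, Matrix.mul_one, h1, Matrix.mul_one, hOO]
  have hMdet : M.det = 1 := by
    have h2 : O.det * Oᵀ.det = 1 := by rw [← Matrix.det_mul, hOO, Matrix.det_one]
    simp only [hM, Matrix.det_mul, Matrix.diagonal_transpose, Matrix.det_diagonal, hf]
    linarith
  have hsub : M.submatrix e e * N.submatrix e e = 1 := by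
    rw [Matrix.submatrix_mul_equiv, hMN, Matrix.submatrix_one_equiv]
  have hJ := det_toBlocks₁₁_eq_det_mul_det_toBlocks₂₂ hsub
  rw [Matrix.det_submatrix_equiv_self, hMdet, one_mul] at hJ
  rw [wedgeNorm_mulVec_eq, wedgeNorm_mulVec_eq]
  exact congrArg Real.sqrt hJ

lemma prod_gt_diagonal (m n : ℕ) (t : ℝ) :
    ∏ l : Fin (m + n), (if (l : ℕ) < m then Real.exp (n * t) else Real.exp (-(m * t))) = 1 := by
  rw [Fin.prod_univ_add]
  simp only [Fin.val_castAdd, Fin.is_lt, if_true, Fin.val_natAdd,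
    Nat.not_lt.2 (Nat.le_add_right m _), if_false, Finset.prod_const, Finset.card_univ, Fintype.card_fin, ← Real.exp_nat_mul,
    ← Real.exp_add]
  rw [Real.exp_eq_one_iff]
  ring

lemma card_filter_val_lt (m n : ℕ) :
    (Finset.univ.filter fun j : Fin (m + n) => (j : ℕ) < m).card = m := by
  rw [Fin.card_filter_val_lt]
  omega

lemma card_compl_filter_val_lt (m n : ℕ) :
    (Finset.univ.filter fun j : Fin (m + n) => (j : ℕ) < m)ᶜ.card = n := by
  rw [Finset.card_compl, card_filter_val_lt, Fintype.card_fin]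
  omega

lemma exists_lintegral_gt_le (m n i : ℕ) (hi1 : 1 ≤ i) (hi : i ≤ m + n - 1) :
    ∃ c : ℝ, 0 < c ∧ ∀ (μ : Measure (Matrix.specialOrthogonalGroup (Fin (m + n)) ℝ)),
      IsProbabilityMeasure μ →
      (∀ k₀ : Matrix.specialOrthogonalGroup (Fin (m + n)) ℝ, μ.map (fun k => k₀ * k) = μ) →
      ∀ t : ℝ, 1 ≤ t → ∀ v : Fin i → Fin (m + n) → ℝ,
        ∫⁻ k, ENNReal.ofReal (wedgeNorm fun a =>
            gt m n t *ᵥ ((k : Matrix (Fin (m + n)) (Fin (m + n)) ℝ) *ᵥ v a))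
              ^ (-(betaExp m n i)) ∂μ
          ≤ ENNReal.ofReal (c * t * Real.exp (-(m * n * t))) *
            ENNReal.ofReal (wedgeNorm v) ^ (-(betaExp m n i)) := by
  set S : Finset (Fin (m + n)) := Finset.univ.filter fun j => (j : ℕ) < m with hS
  have hSc : S.card = m := card_filter_val_lt m n
  have hScc : Sᶜ.card = n := card_compl_filter_val_lt m n
  by_cases him : i ≤ m
  · obtain ⟨p, rfl⟩ := Nat.exists_eq_add_of_le' hi1
    obtain ⟨c, hc, h⟩ := exists_lintegral_coordFlow_le S (p := p) (by omega)
    have hflow : ∀ t, coordFlow S t = gt m n t := by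
      intro t
      rw [coordFlow, gt, hSc, hScc]
      simp only [hS, Finset.mem_filter, Finset.mem_univ, true_and]
    refine ⟨c, hc, fun μ hprob hμ t ht v => ?_⟩
    have h := h μ hprob hμ t ht v
    simpa only [hflow, hSc, hScc, betaExp, if_pos him] using h
  · obtain ⟨p, hp⟩ : ∃ p, i + (p + 1) = m + n := ⟨m + n - i - 1, by omega⟩
    obtain ⟨c, hc, h⟩ := exists_lintegral_coordFlow_le Sᶜ (p := p) (by omega)
    rw [compl_compl, hSc, hScc] at h
    have hβ : betaExp m n i = (n : ℝ) / ((p + 1 : ℕ) : ℝ) := by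
      rw [betaExp, if_neg him]
      congr 1
      have : (i : ℝ) + ((p + 1 : ℕ) : ℝ) = m + n := by exact_mod_cast hp
      linarith
    refine ⟨c, hc, fun μ hprob hμ t ht v => ?_⟩
    rw [hβ]
    set β : ℝ := (n : ℝ) / ((p + 1 : ℕ) : ℝ) with hβdef
    obtain ⟨U, hU, R, hR⟩ := exists_specialOrthogonal_frame (show i ≤ m + n by omega) v
    have hUO := (Matrix.mem_specialOrthogonalGroup_iff.1 hU).1
    let e : Fin i ⊕ Fin (p + 1) ≃ Fin (m + n) := finSumFinEquiv.trans (finCongr hp)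
    have hv : v = fun a => ∑ b, R a b • U (e (Sum.inl b)) := funext hR
    have hvnorm : wedgeNorm v = |R.det| := by
      rw [hv, wedgeNorm_linearComb, wedgeNorm_orthogonal_rows hUO (fun b => e (Sum.inl b))
        (e.injective.comp Sum.inl_injective), mul_one]
    have hwnorm : wedgeNorm (fun b => U (e (Sum.inr b))) = 1 :=
      wedgeNorm_orthogonal_rows hUO _ (e.injective.comp Sum.inr_injective)
    have hk : ∀ k : Matrix.specialOrthogonalGroup (Fin (m + n)) ℝ,
        wedgeNorm (fun a => gt m n t *ᵥ ((k : Matrix (Fin (m + n)) (Fin (m + n)) ℝ) *ᵥ v a))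
          = wedgeNorm v * wedgeNorm (fun b =>
            coordFlow Sᶜ t *ᵥ ((k : Matrix (Fin (m + n)) (Fin (m + n)) ℝ) *ᵥ
              U (e (Sum.inr b)))) := by
      intro k
      have hkO := (Matrix.mem_specialOrthogonalGroup_iff.1 k.2).1
      set O : Matrix (Fin (m + n)) (Fin (m + n)) ℝ :=
        U * (k : Matrix (Fin (m + n)) (Fin (m + n)) ℝ)ᵀ with hOdef
      have hO : O ∈ Matrix.orthogonalGroup (Fin (m + n)) ℝ :=
        mul_mem hUO (transpose_mem_orthogonalGroup hkO)
      have hrow : ∀ l, (k : Matrix (Fin (m + n)) (Fin (m + n)) ℝ) *ᵥ U l = O l := by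
        intro l
        ext j
        simp [hOdef, Matrix.mul_apply, Matrix.mulVec, dotProduct, mul_comm]
      have hlin : (fun a => gt m n t *ᵥ ((k : Matrix (Fin (m + n)) (Fin (m + n)) ℝ) *ᵥ v a))
          = fun a => ∑ b, R a b • (gt m n t *ᵥ O (e (Sum.inl b))) := by
        ext1 a
        rw [congrFun hv a, Matrix.mulVec_sum, Matrix.mulVec_sum]
        refine Finset.sum_congr rfl fun b _ => ?_
        rw [Matrix.mulVec_smul, Matrix.mulVec_smul, hrow]
      rw [hlin, wedgeNorm_linearComb, hvnorm]
      simp only [hrow, gt, coordFlow]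
      congr 1
      refine wedgeNorm_diagonal_mulVec_compl e hO (fun l => ?_) (prod_gt_diagonal m n t)
      rw [compl_compl, hSc, hScc]
      simp only [hS, Finset.mem_compl, Finset.mem_filter, Finset.mem_univ, true_and]
      split_ifs <;> simp [← Real.exp_add] at *
    have h := h μ hprob hμ t ht fun b => U (e (Sum.inr b))
    rw [hwnorm, ENNReal.ofReal_one, ENNReal.one_rpow, mul_one] at h
    calc _ = ∫⁻ k, ENNReal.ofReal (wedgeNorm v) ^ (-β) * ENNReal.ofReal (wedgeNorm (fun b =>
            coordFlow Sᶜ t *ᵥ ((k : Matrix (Fin (m + n)) (Fin (m + n)) ℝ) *ᵥ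
              U (e (Sum.inr b))))) ^ (-β) ∂μ := by
          refine lintegral_congr fun k => ?_
          rw [hk k, ENNReal.ofReal_mul (wedgeNorm_nonneg _),
            ENNReal.mul_rpow_of_ne_top ENNReal.ofReal_ne_top ENNReal.ofReal_ne_top]
      _ = ENNReal.ofReal (wedgeNorm v) ^ (-β) * ∫⁻ k, ENNReal.ofReal (wedgeNorm (fun b =>
            coordFlow Sᶜ t *ᵥ ((k : Matrix (Fin (m + n)) (Fin (m + n)) ℝ) *ᵥ
              U (e (Sum.inr b))))) ^ (-β) ∂μ := by
          refine lintegral_const_mul _ ?_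
          exact (ENNReal.measurable_ofReal.comp ((measurable_wedgeNorm_mulVec _).comp
            (measurable_mulVec_specialOrthogonal.comp
              (measurable_id.prodMk (measurable_const
                (a := fun b => U (e (Sum.inr b)))))))).pow_const _
      _ ≤ _ := by
          rw [mul_comm, mul_comm (m : ℝ) (n : ℝ)]
          exact mul_le_mul_left h _

end Duality

/-- Proposition 3.1: there is `c > 0` depending only on `m, n` such that for every `t ≥ 1`,
every `1 ≤ i ≤ m+n-1` and every nonzero decomposable `v ∈ ⋀^i ℝ^{m+n}`,
`∫_{SO(m+n)} ‖g_t k v‖^{-β_i} dk ≤ c·t·e^{-mnt}·‖v‖^{-β_i}`, where `dk` is the Haar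
probability measure on `SO(m+n)` (characterized as a left-invariant probability measure),
and decomposable `i`-vectors are represented by `i`-tuples of spanning vectors. -/
theorem integral_SO_wedgeNorm_bound
    (m n : ℕ) (hm : 1 ≤ m) (hn : 1 ≤ n) :
    ∃ c : ℝ, 0 < c ∧
      ∀ (μ : Measure ↥(Matrix.specialOrthogonalGroup (Fin (m + n)) ℝ)),
        IsProbabilityMeasure μ →
        (∀ k₀ : ↥(Matrix.specialOrthogonalGroup (Fin (m + n)) ℝ),
          μ.map (fun k => k₀ * k) = μ) →
        ∀ (t : ℝ), 1 ≤ t →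
        ∀ (i : ℕ), 1 ≤ i → i ≤ m + n - 1 →
        ∀ v : Fin i → (Fin (m + n) → ℝ), wedgeNorm v ≠ 0 →
          ∫⁻ k, ENNReal.ofReal
              (wedgeNorm (fun a => (gt m n t).mulVec
                ((k : Matrix (Fin (m+n)) (Fin (m+n)) ℝ).mulVec (v a))) ^ (-(betaExp m n i))) ∂μ
            ≤ ENNReal.ofReal (c * t * Real.exp (-(m * n * t)) * wedgeNorm v ^ (-(betaExp m n i))) := by
  have hex : ∀ i : ℕ, ∃ c : ℝ, 0 < c ∧ (1 ≤ i → i ≤ m + n - 1 →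
      ∀ (μ : Measure (Matrix.specialOrthogonalGroup (Fin (m + n)) ℝ)),
      IsProbabilityMeasure μ →
      (∀ k₀ : Matrix.specialOrthogonalGroup (Fin (m + n)) ℝ, μ.map (fun k => k₀ * k) = μ) →
      ∀ t : ℝ, 1 ≤ t → ∀ v : Fin i → Fin (m + n) → ℝ,
        ∫⁻ k, ENNReal.ofReal (wedgeNorm fun a =>
            (gt m n t).mulVec ((k : Matrix (Fin (m + n)) (Fin (m + n)) ℝ).mulVec (v a)))
              ^ (-(betaExp m n i)) ∂μ
          ≤ ENNReal.ofReal (c * t * Real.exp (-(m * n * t))) *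
            ENNReal.ofReal (wedgeNorm v) ^ (-(betaExp m n i))) := by
    intro i
    by_cases hi : 1 ≤ i ∧ i ≤ m + n - 1
    · obtain ⟨c, hc, h⟩ := exists_lintegral_gt_le m n i hi.1 hi.2
      exact ⟨c, hc, fun _ _ => h⟩
    · exact ⟨1, one_pos, fun h1 h2 => absurd ⟨h1, h2⟩ hi⟩
  choose c hc h using hex
  refine ⟨∑ i ∈ Finset.range (m + n), c i,
    Finset.sum_pos (fun i _ => hc i) ⟨0, Finset.mem_range.2 (by omega)⟩, ?_⟩
  intro μ hprob hμ t ht i hi1 hi v hv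
  have hβ : 0 < betaExp m n i := by
    have hi1' : (0 : ℝ) < i := by exact_mod_cast hi1
    have hm' : (0 : ℝ) < m := by exact_mod_cast hm
    have hn' : (0 : ℝ) < n := by exact_mod_cast hn
    have hlt : (i : ℝ) < m + n := by exact_mod_cast (show i < m + n by omega)
    rw [betaExp]
    split_ifs
    · positivity
    · exact div_pos hn' (by linarith)
  have hle : c i ≤ ∑ i ∈ Finset.range (m + n), c i :=
    Finset.single_le_sum (fun j _ => (hc j).le) (Finset.mem_range.2 (by omega))
  have hvpos : 0 < wedgeNorm v := (wedgeNorm_nonneg v).lt_of_ne' hv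
  rw [ENNReal.ofReal_mul' (Real.rpow_nonneg hvpos.le _), ← ENNReal.ofReal_rpow_of_pos hvpos]
  calc _ ≤ ∫⁻ k, ENNReal.ofReal (wedgeNorm fun a =>
            (gt m n t).mulVec ((k : Matrix (Fin (m + n)) (Fin (m + n)) ℝ).mulVec (v a)))
              ^ (-(betaExp m n i)) ∂μ := by
        refine lintegral_mono fun k => ?_
        rcases (wedgeNorm_nonneg (fun a => (gt m n t).mulVec
          ((k : Matrix (Fin (m + n)) (Fin (m + n)) ℝ).mulVec (v a)))).eq_or_lt with h0 | h0
        · simp only [← h0, Real.zero_rpow (neg_ne_zero.2 hβ.ne'), ENNReal.ofReal_zero, zero_le]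
        · exact (ENNReal.ofReal_rpow_of_pos h0).ge
    _ ≤ _ := h i hi1 hi μ hprob hμ t ht v
    _ ≤ _ := by
        refine mul_le_mul_left (ENNReal.ofReal_le_ofReal ?_) _
        gcongr
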